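/- arXiv:2404.19005 — 6 statements merged into one kernel-verified Lean document; each statement's English description precedes it below -/
import Mathlib

section
/- (Asymptotic XEB of block-random IQP circuits with uniform in-block CNOT circuits; anticoncentration of deep hypercube IQP circuits.) Let m ≥ 2. For every connected graph G on b blocks and every ordered partition of its edge set into matchings, consider the hyperdepth-L block-random degree-2 IQP ensemble with randomized parallel transversal CNOT gates in which, additionally, each in-block step applies to each block an independent uniformly random in-block CNOT circuit, i.e., the permutation unitary |x⟩ ↦ |A x⟩ for A uniform in GL(m, 𝔽₂). Then the ideal XEB score converges as L → ∞ to the uniform-IQP value: lim_{L→∞} χ̄(L) = 2 − 2^(1−m·b). -/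
open scoped BigOperators
open Matrix

namespace Stmt9

/-- One bit. -/
abbrev B2 := ZMod 2

/-- Computational basis labels: one bit per (block, qubit-in-block). -/
abbrev St (b m : ℕ) := Fin b × Fin m → B2

/-- `(-1)^a` as a complex number. -/
def sgn (a : B2) : ℂ := (-1 : ℂ) ^ a.val

/-- Parameters of a uniformly random degree-2 IQP circuit on a single block of `m`
qubits. -/
abbrev BlockIQP (m : ℕ) := (Fin m → B2) × ({p : Fin m × Fin m // p.1 < p.2} → B2)

/-- Phase polynomial of a layer of independent in-block degree-2 IQP circuits. -/
def blockPhase (b m : ℕ) (θ : Fin b → BlockIQP m) (x : St b m) : B2 :=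
  ∑ k : Fin b,
    ((∑ p : {p : Fin m × Fin m // p.1 < p.2}, (θ k).2 p * x (k, p.1.1) * x (k, p.1.2)) +
      ∑ i : Fin m, (θ k).1 i * x (k, i))

/-- The diagonal unitary of a layer of in-block degree-2 IQP circuits. -/
noncomputable def iqpMat (b m : ℕ) (θ : Fin b → BlockIQP m) : Matrix (St b m) (St b m) ℂ :=
  Matrix.diagonal fun x => sgn (blockPhase b m θ x)

/-- Permutation matrix `V|x⟩ = |σ x⟩`. -/
noncomputable def permMat (b m : ℕ) (σ : St b m → St b m) : Matrix (St b m) (St b m) ℂ :=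
  Matrix.of fun p q => if p = σ q then 1 else 0

/-- Action on basis states of the parallel transversal CNOTs along the matching encoded
by the involution `c`, with direction bit `d` read at the smaller endpoint of each edge. -/
def cnotPerm (b m : ℕ) (c : Fin b → Fin b) (d : Fin b → B2) (x : St b m) : St b m := fun q =>
  if c q.1 = q.1 then x q
  else
    let ctl := if d (min q.1 (c q.1)) = 0 then min q.1 (c q.1) else max q.1 (c q.1)
    if q.1 = ctl then x q else x q + x (c q.1, q.2)

/-- Action on basis states of a layer of in-block CNOT circuits `|x⟩ ↦ |A x⟩`, one
invertible matrix `A ∈ GL(m, 𝔽₂)` per block. -/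
def inblockCnot (b m : ℕ) (A : Fin b → Matrix.GeneralLinearGroup (Fin m) B2)
    (x : St b m) : St b m := fun q =>
  ((A q.1 : Matrix (Fin m) (Fin m) B2).mulVec fun j => x (q.1, j)) q.2

/-- Random data of one step of a hyperlayer: in-block IQP parameters, an in-block
uniformly random CNOT circuit (an element of `GL(m,𝔽₂)`) for every block, and a
direction bit for every edge of the matching. -/
abbrev StepP (b m : ℕ) :=
  (Fin b → BlockIQP m) × (Fin b → Matrix.GeneralLinearGroup (Fin m) B2) × (Fin b → B2)

/-- One step: in-block random degree-2 IQP circuits together with in-block uniformly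
random CNOT circuits, followed by randomized parallel transversal CNOTs along the
matching `c`. -/
noncomputable def stepMat (b m : ℕ) (c : Fin b → Fin b) (p : StepP b m) :
    Matrix (St b m) (St b m) ℂ :=
  permMat b m (cnotPerm b m c p.2.2) * (permMat b m (inblockCnot b m p.2.1) * iqpMat b m p.1)

/-- Time-ordered product: `f 0` is applied first. -/
noncomputable def seqProd {M : Type*} [Monoid M] {k : ℕ} (f : Fin k → M) : M :=
  ((List.finRange k).map f).reverse.prod

/-- Random data of a hyperdepth-`L` circuit. -/
abbrev ParamT (b m r L : ℕ) := (Fin L → Fin r → StepP b m) × (Fin b → BlockIQP m)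

/-- The hyperdepth-`L` block-random circuit with in-block CNOT circuits. -/
noncomputable def circuitMat (b m r L : ℕ) (c : Fin r → Fin b → Fin b) (θ : ParamT b m r L) :
    Matrix (St b m) (St b m) ℂ :=
  iqpMat b m θ.2 *
    seqProd fun l : Fin L => seqProd fun t : Fin r => stepMat b m (c t) (θ.1 l t)

/-- The uniform superposition `|+^N⟩`, `N = m·b`. -/
noncomputable def plusV (b m : ℕ) : St b m → ℂ := fun _ => (((Real.sqrt 2)⁻¹ : ℝ) ^ (m * b) : ℝ)

/-- The `N`-fold Hadamard, `N = m·b`. -/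
noncomputable def Hmat (b m : ℕ) : Matrix (St b m) (St b m) ℂ :=
  Matrix.of fun x y => (((Real.sqrt 2)⁻¹ : ℝ) ^ (m * b) : ℝ) * sgn (∑ i, x i * y i)

set_option synthInstance.maxSize 1024

/-- The ideal XEB score `χ̄(L) = 2^N Σ_x E[p_C(x)²] − 1`. -/
noncomputable def xeb (b m r : ℕ) (c : Fin r → Fin b → Fin b) (L : ℕ) : ℝ :=
  (2 : ℝ) ^ (m * b) *
    ((∑ θ : ParamT b m r L, ∑ x : St b m,
        (Complex.normSq (((Hmat b m * circuitMat b m r L c θ).mulVec (plusV b m)) x)) ^ 2) /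
      (Fintype.card (ParamT b m r L))) - 1


section Sign

/-- `(-1)^a` as a real number. -/
def sgnR (a : B2) : ℝ := (-1 : ℝ) ^ a.val

lemma B2.eq_zero_or_eq_one (a : B2) : a = 0 ∨ a = 1 := by
  revert a; decide

lemma sgnR_zero : sgnR 0 = 1 := by simp [sgnR]

lemma sgnR_one : sgnR 1 = -1 := by
  have : (1 : B2).val = 1 := rfl
  simp [sgnR, this]

lemma sgnR_add (a c : B2) : sgnR (a + c) = sgnR a * sgnR c := by
  have h2 : (1 : B2) + 1 = 0 := rfl
  rcases B2.eq_zero_or_eq_one a with rfl | rfl <;>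
    rcases B2.eq_zero_or_eq_one c with rfl | rfl <;>
    simp [sgnR_zero, sgnR_one, h2]

lemma sgn_eq_ofReal (a : B2) : sgn a = (sgnR a : ℂ) := by
  simp [sgn, sgnR]

lemma sgn_add (a c : B2) : sgn (a + c) = sgn a * sgn c := by
  simp [sgn_eq_ofReal, sgnR_add]

open Classical in
/-- Orthogonality of characters with values in `±1`. -/
lemma sum_sgnR_hom {G : Type*} [AddCommGroup G] [Fintype G] (χ : G →+ B2) :
    ∑ g, sgnR (χ g) = if ∀ g, χ g = 0 then (Fintype.card G : ℝ) else 0 := by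
  split_ifs with h
  · simp [h, sgnR_zero]
  · push Not at h
    obtain ⟨g₀, hg₀⟩ := h
    have h1 : χ g₀ = 1 := (B2.eq_zero_or_eq_one _).resolve_left hg₀
    have := Equiv.sum_comp (Equiv.addRight g₀) fun g => sgnR (χ g)
    simp only [Equiv.coe_addRight, map_add, sgnR_add, h1, sgnR_one, mul_neg, mul_one,
      Finset.sum_neg_distrib] at this
    linarith

end Sign

section Average

variable {R : Type*} [Ring R] [Algebra ℝ R]

/-- The uniform average of a function on a finite type. -/
noncomputable def avg {X E : Type*} [Fintype X] [AddCommGroup E] [Module ℝ E] (g : X → E) : E :=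
  (Fintype.card X : ℝ)⁻¹ • ∑ x, g x

lemma avg_equiv {X Y E : Type*} [Fintype X] [Fintype Y] [AddCommGroup E] [Module ℝ E]
    (e : X ≃ Y) (g : Y → E) : avg (fun x => g (e x)) = avg g := by
  simp only [avg, Equiv.sum_comp e g, Fintype.card_congr e]

lemma avg_prod_mul {X Y : Type*} [Fintype X] [Fintype Y] (g : X → R) (k : Y → R) :
    avg (fun p : X × Y => g p.1 * k p.2) = avg g * avg k := by
  simp only [avg, Fintype.sum_prod_type, ← Finset.sum_mul_sum, Fintype.card_prod, Nat.cast_mul,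
    mul_inv, smul_mul_assoc, mul_smul_comm, smul_smul, mul_comm]

/-- The average of an ordered product of independent factors is the product of averages. -/
lemma avg_pi_prod {X : Type*} [Fintype X] {k : ℕ} (g : Fin k → X → R) :
    avg (fun f : Fin k → X => (List.ofFn fun i => g i (f i)).prod) =
      (List.ofFn fun i => avg (g i)).prod := by
  induction k with
  | zero => simp [avg]
  | succ k ih =>
    rw [← avg_equiv (Fin.consEquiv fun _ => X)]
    simp only [List.ofFn_succ, List.prod_cons, ← ih]
    rw [← avg_prod_mul]
    rfl

end Average

section Monomial

variable {b m : ℕ}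

/-- The matrix of `|q⟩ ↦ (-1)^{φ q} |σ q⟩`. -/
noncomputable def mono (σ : St b m → St b m) (φ : St b m → B2) : Matrix (St b m) (St b m) ℂ :=
  Matrix.of fun p q => if p = σ q then sgn (φ q) else 0

lemma mono_mul_mono (σ τ : St b m → St b m) (φ ψ : St b m → B2) :
    mono σ φ * mono τ ψ = mono (fun q => σ (τ q)) (fun q => ψ q + φ (τ q)) := by
  ext p q
  simp only [mono, Matrix.mul_apply, Matrix.of_apply, mul_ite, mul_zero, Finset.sum_ite_eq',
    Finset.mem_univ, if_true, ite_mul, zero_mul, sgn_add]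
  split_ifs <;> ring

lemma permMat_eq_mono (σ : St b m → St b m) : permMat b m σ = mono σ 0 := by
  ext p q
  simp [permMat, mono, sgn]

lemma iqpMat_eq_mono (θ : Fin b → BlockIQP m) :
    iqpMat b m θ = mono id (blockPhase b m θ) := by
  ext p q
  by_cases h : p = q
  · subst h; simp [iqpMat, mono]
  · simp [iqpMat, mono, h]

/-- Signed composition with `σ × σ` on functions of pairs of basis labels. -/
def monoOp (σ : St b m → St b m) (B : St b m → St b m → B2) :
    Module.End ℝ (St b m × St b m → ℝ) where
  toFun h s := sgnR (B s.1 s.2) * h (σ s.1, σ s.2)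
  map_add' h k := by ext s; simp [mul_add]
  map_smul' r h := by ext s; simp [mul_left_comm]

lemma monoOp_apply (σ : St b m → St b m) (B : St b m → St b m → B2)
    (h : St b m × St b m → ℝ) (s : St b m × St b m) :
    monoOp σ B h s = sgnR (B s.1 s.2) * h (σ s.1, σ s.2) := rfl

lemma monoOp_mul_monoOp (σ τ : St b m → St b m) (B C : St b m → St b m → B2) :
    monoOp τ C * monoOp σ B =
      monoOp (fun q => σ (τ q)) (fun x y => C x y + B (τ x) (τ y)) := by
  refine LinearMap.ext fun h => funext fun s => ?_
  simp only [Module.End.mul_apply, monoOp_apply, sgnR_add, mul_assoc]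

/-- `M` is a monomial matrix with injective additive permutation part and quadratic phase, and
`K` is the operator on functions of pairs given by its permutation part and polar form. -/
def Represents (M : Matrix (St b m) (St b m) ℂ)
    (K : Module.End ℝ (St b m × St b m → ℝ)) : Prop :=
  ∃ (σ : St b m →+ St b m) (φ : St b m → B2) (B : St b m → St b m → B2),
    Function.Injective σ ∧
    (∀ y a c, φ y + φ (y + a) + φ (y + c) + φ (y + c + a) = B a c) ∧
    M = mono σ φ ∧ K = monoOp σ B

lemma Represents.one :
    Represents (1 : Matrix (St b m) (St b m) ℂ) (1 : Module.End ℝ (St b m × St b m → ℝ)) := by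
  refine ⟨AddMonoidHom.id _, 0, 0, Function.injective_id, by simp, ?_, ?_⟩
  · ext p q
    simp [mono, Matrix.one_apply, sgn]
  · refine LinearMap.ext fun h => funext fun s => ?_
    simp [monoOp_apply, sgnR_zero]

lemma Represents.mul {M M' : Matrix (St b m) (St b m) ℂ}
    {K K' : Module.End ℝ (St b m × St b m → ℝ)} (h : Represents M K) (h' : Represents M' K') :
    Represents (M * M') (K' * K) := by
  obtain ⟨σ, φ, B, hσ, hB, rfl, rfl⟩ := h
  obtain ⟨σ', φ', B', hσ', hB', rfl, rfl⟩ := h'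
  refine ⟨σ.comp σ', fun q => φ' q + φ (σ' q), fun x y => B' x y + B (σ' x) (σ' y),
    hσ.comp hσ', fun y a c => ?_, mono_mul_mono _ _ _ _, monoOp_mul_monoOp _ _ _ _⟩
  simp only [← hB (σ' y), ← hB' y, map_add]
  ring

lemma Represents.seqProd {k : ℕ} {M : Fin k → Matrix (St b m) (St b m) ℂ}
    {K : Fin k → Module.End ℝ (St b m × St b m → ℝ)} (h : ∀ i, Represents (M i) (K i)) :
    Represents (seqProd M) (List.ofFn K).prod := by
  rw [Stmt9.seqProd, ← List.ofFn_eq_map]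
  induction k with
  | zero => simpa using Represents.one
  | succ k ih =>
    simp only [List.ofFn_succ, List.reverse_cons, List.prod_append, List.prod_cons,
      List.prod_nil, mul_one]
    exact (ih fun i => h i.succ).mul (h 0)

lemma ofReal_sqrt_two_pow_mul_self (n : ℕ) :
    ((Real.sqrt 2)⁻¹ ^ n) * ((Real.sqrt 2)⁻¹ ^ n) = ((2 : ℝ) ^ n)⁻¹ := by
  rw [← mul_pow, ← mul_inv, Real.mul_self_sqrt (by norm_num), inv_pow]

lemma amplitude_mono (σ : St b m → St b m) (φ : St b m → B2) (x : St b m) :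
    ((Hmat b m * mono σ φ).mulVec (plusV b m)) x =
      ((((2 : ℝ) ^ (m * b))⁻¹ * ∑ y, sgnR (∑ i, x i * σ y i + φ y) : ℝ) : ℂ) := by
  have hn := ofReal_sqrt_two_pow_mul_self (m * b)
  rw [← hn]
  simp only [Matrix.mulVec, dotProduct, Matrix.mul_apply, mono, Hmat, plusV, Matrix.of_apply,
    mul_ite, mul_zero, Finset.sum_ite_eq', Finset.mem_univ, if_true, sgn_eq_ofReal]
  rw [Finset.mul_sum]
  push_cast
  refine Finset.sum_congr rfl fun y _ => ?_
  rw [sgnR_add]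
  push_cast
  ring

lemma card_St : Fintype.card (St b m) = 2 ^ (m * b) := by
  simp [mul_comm]

/-- Pairing with `z`, as a homomorphism. -/
def dotHom (z : St b m) : St b m →+ B2 where
  toFun x := ∑ i, x i * z i
  map_zero' := by simp
  map_add' x y := by simp [add_mul, Finset.sum_add_distrib]

lemma sum_sgnR_dot (z : St b m) :
    ∑ x : St b m, sgnR (∑ i, x i * z i) = if z = 0 then (2 : ℝ) ^ (m * b) else 0 := by
  classical
  have := sum_sgnR_hom (dotHom z)
  rw [card_St] at this
  push_cast at this
  refine this.trans (if_congr ⟨fun h => ?_, ?_⟩ rfl rfl)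
  · funext i
    simpa [dotHom, Pi.single_apply] using h (Pi.single i 1)
  · rintro rfl
    simp [dotHom]

lemma sq_sum_eq_sum_shift {G : Type*} [AddGroup G] [Fintype G] (F : G → ℝ) :
    (∑ y, F y) ^ 2 = ∑ a, ∑ y, F y * F (y + a) := by
  rw [pow_two, Finset.sum_mul_sum, Finset.sum_comm (f := fun a y => F y * F (y + a))]
  refine Finset.sum_congr rfl fun y _ => ?_
  exact (Equiv.sum_comp (Equiv.addLeft y) fun z => F y * F z).symm

lemma sum_pow_four_amplitude (σ : St b m →+ St b m) (φ : St b m → B2)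
    (B : St b m → St b m → B2) (hσ : Function.Injective σ)
    (hB : ∀ y a c, φ y + φ (y + a) + φ (y + c) + φ (y + c + a) = B a c) :
    ∑ x : St b m, (∑ y, sgnR (∑ i, x i * σ y i + φ y)) ^ 4 =
      (2 : ℝ) ^ (m * b) * 2 ^ (m * b) * ∑ s : St b m × St b m, sgnR (B s.1 s.2) := by
  set Q : St b m → ℝ := fun a => ∑ y, sgnR (φ y + φ (y + a)) with hQ
  have h1 : ∀ x : St b m, (∑ y, sgnR (∑ i, x i * σ y i + φ y)) ^ 2 =
      ∑ a, sgnR (∑ i, x i * σ a i) * Q a := by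
    intro x
    rw [sq_sum_eq_sum_shift]
    refine Finset.sum_congr rfl fun a _ => ?_
    rw [hQ, Finset.mul_sum]
    refine Finset.sum_congr rfl fun y _ => ?_
    rw [← sgnR_add, ← sgnR_add]
    congr 1
    simp only [map_add, Pi.add_apply, mul_add, Finset.sum_add_distrib]
    linear_combination (CharTwo.add_self_eq_zero (∑ i, x i * σ y i))
  have h2 : ∀ a, Q a ^ 2 = 2 ^ (m * b) * ∑ c, sgnR (B a c) := by
    intro a
    have : ∀ c y : St b m, sgnR (φ y + φ (y + a)) * sgnR (φ (y + c) + φ (y + c + a)) =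
        sgnR (B a c) := by
      intro c y
      rw [← sgnR_add, ← hB y a c, ← add_assoc]
    rw [hQ, sq_sum_eq_sum_shift, Finset.mul_sum]
    refine Finset.sum_congr rfl fun c _ => ?_
    simp only [this, Finset.sum_const, Finset.card_univ, card_St, nsmul_eq_mul]
    push_cast; ring
  have h3 : ∀ a a' : St b m, ∑ x : St b m, sgnR (∑ i, x i * σ a i) * sgnR (∑ i, x i * σ a' i) =
      if a = a' then (2 : ℝ) ^ (m * b) else 0 := by
    intro a a'
    simp only [← sgnR_add, ← Finset.sum_add_distrib, ← mul_add, ← Pi.add_apply, ← map_add]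
    rw [sum_sgnR_dot]
    refine if_congr ?_ rfl rfl
    rw [map_eq_zero_iff _ hσ]
    simp only [funext_iff, Pi.add_apply, Pi.zero_apply, CharTwo.add_eq_zero]
  calc ∑ x : St b m, (∑ y, sgnR (∑ i, x i * σ y i + φ y)) ^ 4
      = ∑ x : St b m, ∑ a, ∑ a', (sgnR (∑ i, x i * σ a i) * Q a) *
          (sgnR (∑ i, x i * σ a' i) * Q a') := by
        refine Finset.sum_congr rfl fun x _ => ?_
        rw [← Finset.sum_mul_sum, ← h1]; ring
    _ = ∑ a, ∑ a', (∑ x : St b m, sgnR (∑ i, x i * σ a i) * sgnR (∑ i, x i * σ a' i)) *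
          (Q a * Q a') := by
        rw [Finset.sum_comm]
        refine Finset.sum_congr rfl fun a _ => ?_
        rw [Finset.sum_comm]
        refine Finset.sum_congr rfl fun a' _ => ?_
        rw [Finset.sum_mul]
        refine Finset.sum_congr rfl fun x _ => ?_
        ring
    _ = ∑ a, 2 ^ (m * b) * Q a ^ 2 := by
        simp only [h3, ite_mul, zero_mul, Finset.sum_ite_eq, Finset.mem_univ, if_true, pow_two]
    _ = _ := by
        simp only [h2, Fintype.sum_prod_type, Finset.mul_sum, mul_assoc]

lemma Represents.sum_normSq_sq {M : Matrix (St b m) (St b m) ℂ}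
    {K : Module.End ℝ (St b m × St b m → ℝ)} (h : Represents M K) :
    (2 : ℝ) ^ (m * b) *
        ∑ x, (Complex.normSq (((Hmat b m * M).mulVec (plusV b m)) x)) ^ 2 =
      ((2 : ℝ) ^ (m * b))⁻¹ * ∑ s, K 1 s := by
  obtain ⟨σ, φ, B, hσ, hB, rfl, rfl⟩ := h
  simp only [amplitude_mono, Complex.normSq_ofReal, monoOp_apply, Pi.one_apply, mul_one]
  have := sum_pow_four_amplitude σ φ B hσ hB
  calc _ = (2 : ℝ) ^ (m * b) * ((((2 : ℝ) ^ (m * b))⁻¹) ^ 4 *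
        ∑ x : St b m, (∑ y, sgnR (∑ i, x i * σ y i + φ y)) ^ 4) := by
        congr 1
        rw [Finset.mul_sum]
        refine Finset.sum_congr rfl fun x _ => ?_
        ring
    _ = _ := by
        rw [this]
        have : (2 : ℝ) ^ (m * b) ≠ 0 := by positivity
        field_simp

end Monomial

section Circuit

variable {b m : ℕ}

/-- The polar form of `blockPhase`. -/
def blockPolar (θ : Fin b → BlockIQP m) (x y : St b m) : B2 :=
  ∑ k, ∑ p : {p : Fin m × Fin m // p.1 < p.2},
    (θ k).2 p * (x (k, p.1.1) * y (k, p.1.2) + x (k, p.1.2) * y (k, p.1.1))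

lemma blockPhase_polar (θ : Fin b → BlockIQP m) (y a c : St b m) :
    blockPhase b m θ y + blockPhase b m θ (y + a) + blockPhase b m θ (y + c) +
      blockPhase b m θ (y + c + a) = blockPolar θ a c := by
  have h2 : (2 : B2) = 0 := rfl
  simp only [blockPhase, blockPolar, ← Finset.sum_add_distrib]
  refine Finset.sum_congr rfl fun k _ => ?_
  have hlin : ∑ i : Fin m, (θ k).1 i * y (k, i) + ∑ i : Fin m, (θ k).1 i * (y + a) (k, i) +
      ∑ i : Fin m, (θ k).1 i * (y + c) (k, i) +
      ∑ i : Fin m, (θ k).1 i * (y + c + a) (k, i) = 0 := by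
    simp only [← Finset.sum_add_distrib]
    refine Finset.sum_eq_zero fun i _ => ?_
    simp only [Pi.add_apply]
    linear_combination ((θ k).1 i * (2 * y (k, i) + a (k, i) + c (k, i))) * h2
  have hquad : ∀ p : {p : Fin m × Fin m // p.1 < p.2},
      (θ k).2 p * y (k, p.1.1) * y (k, p.1.2) +
      (θ k).2 p * (y + a) (k, p.1.1) * (y + a) (k, p.1.2) +
      (θ k).2 p * (y + c) (k, p.1.1) * (y + c) (k, p.1.2) +
      (θ k).2 p * (y + c + a) (k, p.1.1) * (y + c + a) (k, p.1.2) =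
      (θ k).2 p * (a (k, p.1.1) * c (k, p.1.2) + a (k, p.1.2) * c (k, p.1.1)) := by
    intro p
    simp only [Pi.add_apply]
    generalize (θ k).2 p = t
    generalize y (k, p.1.1) = y₁
    generalize y (k, p.1.2) = y₂
    generalize a (k, p.1.1) = a₁
    generalize a (k, p.1.2) = a₂
    generalize c (k, p.1.1) = c₁
    generalize c (k, p.1.2) = c₂
    revert t y₁ y₂ a₁ a₂ c₁ c₂
    decide
  simp only [← hquad, Finset.sum_add_distrib]
  linear_combination hlin

/-- `inblockCnot` as an additive homomorphism. -/
def inblockHom (A : Fin b → Matrix.GeneralLinearGroup (Fin m) B2) : St b m →+ St b m where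
  toFun := inblockCnot b m A
  map_zero' := by
    funext q
    exact congrFun (Matrix.mulVec_zero (A q.1 : Matrix (Fin m) (Fin m) B2)) q.2
  map_add' x y := by
    funext q
    exact congrFun (Matrix.mulVec_add (A q.1 : Matrix (Fin m) (Fin m) B2) _ _) q.2

lemma inblockHom_injective (A : Fin b → Matrix.GeneralLinearGroup (Fin m) B2) :
    Function.Injective (inblockHom A) := by
  have key : ∀ x, inblockCnot b m (fun k => (A k)⁻¹) (inblockCnot b m A x) = x := by
    intro x
    funext q
    change (((A q.1)⁻¹ : Matrix.GeneralLinearGroup (Fin m) B2) :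
      Matrix (Fin m) (Fin m) B2).mulVec
        ((A q.1 : Matrix (Fin m) (Fin m) B2).mulVec fun j => x (q.1, j)) q.2 = x q
    rw [Matrix.mulVec_mulVec, ← Units.val_mul, inv_mul_cancel, Units.val_one, Matrix.one_mulVec]
  exact Function.LeftInverse.injective key

/-- `cnotPerm` as an additive homomorphism. -/
def cnotHom (c : Fin b → Fin b) (d : Fin b → B2) : St b m →+ St b m where
  toFun := cnotPerm b m c d
  map_zero' := by
    funext q
    simp [cnotPerm]
  map_add' x y := by
    funext q
    simp only [cnotPerm, Pi.add_apply]
    split_ifs <;> ring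

/-- The control of the edge at `u`. -/
def control (c : Fin b → Fin b) (d : Fin b → B2) (u : Fin b) : Fin b :=
  if d (min u (c u)) = 0 then min u (c u) else max u (c u)

lemma cnotPerm_apply (c : Fin b → Fin b) (d : Fin b → B2) (x : St b m) (q : Fin b × Fin m) :
    cnotPerm b m c d x q = if c q.1 = q.1 then x q
      else if q.1 = control c d q.1 then x q else x q + x (c q.1, q.2) := rfl

lemma control_partner {c : Fin b → Fin b} (hc : Function.Involutive c) (d : Fin b → B2)
    (u : Fin b) : control c d (c u) = control c d u := by
  simp only [control, hc u, min_comm, max_comm]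

lemma control_eq_or (c : Fin b → Fin b) (d : Fin b → B2) (u : Fin b) :
    control c d u = u ∨ control c d u = c u := by
  unfold control
  split_ifs
  · exact min_choice _ _
  · exact max_choice _ _

lemma cnotHom_injective {c : Fin b → Fin b} (hc : Function.Involutive c) (d : Fin b → B2) :
    Function.Injective (cnotHom (m := m) c d) := by
  have key : ∀ x, cnotPerm b m c d (cnotPerm b m c d x) = x := by
    intro x
    funext q
    simp only [cnotPerm_apply]
    by_cases h : c q.1 = q.1
    · simp [h]
    by_cases h' : q.1 = control c d q.1
    · rw [if_neg h, if_pos h', if_neg h, if_pos h']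
    · have hc' : c q.1 = control c d (c q.1) := by
        rw [control_partner hc]
        exact ((control_eq_or c d q.1).resolve_left (Ne.symm h')).symm
      rw [if_neg h, if_neg h', if_neg h, if_neg h', if_pos hc', ite_self, add_assoc,
        CharTwo.add_self_eq_zero, add_zero]
  exact Function.LeftInverse.injective key

/-- The permutation part of one step. -/
def stepHom (c : Fin b → Fin b)
    (p : (Fin b → Matrix.GeneralLinearGroup (Fin m) B2) × (Fin b → B2)) : St b m →+ St b m :=
  (cnotHom c p.2).comp (inblockHom p.1)

lemma stepHom_injective {c : Fin b → Fin b} (hc : Function.Involutive c)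
    (p : (Fin b → Matrix.GeneralLinearGroup (Fin m) B2) × (Fin b → B2)) :
    Function.Injective (stepHom c p) :=
  (cnotHom_injective hc p.2).comp (inblockHom_injective p.1)

/-- The operator of one step. -/
def stepOp (c : Fin b → Fin b) (p : StepP b m) : Module.End ℝ (St b m × St b m → ℝ) :=
  monoOp (stepHom c p.2) (blockPolar p.1)

lemma represents_iqpMat (θ : Fin b → BlockIQP m) :
    Represents (iqpMat b m θ) (monoOp id (blockPolar θ)) :=
  ⟨AddMonoidHom.id _, _, _, Function.injective_id, blockPhase_polar θ, iqpMat_eq_mono θ, rfl⟩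

lemma represents_stepMat {c : Fin b → Fin b} (hc : Function.Involutive c) (p : StepP b m) :
    Represents (stepMat b m c p) (stepOp c p) := by
  refine ⟨stepHom c p.2, _, _, stepHom_injective hc p.2, blockPhase_polar p.1, ?_, rfl⟩
  rw [stepMat, iqpMat_eq_mono, permMat_eq_mono, permMat_eq_mono, mono_mul_mono, mono_mul_mono]
  simp only [Pi.zero_apply, add_zero]
  rfl

/-- The averaged operator of one step. -/
noncomputable def transfer (c : Fin b → Fin b) : Module.End ℝ (St b m × St b m → ℝ) :=
  avg (stepOp (m := m) c)

/-- The averaged operator of the final layer. -/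
noncomputable def finalTransfer (b m : ℕ) : Module.End ℝ (St b m × St b m → ℝ) :=
  avg fun θ : Fin b → BlockIQP m => monoOp id (blockPolar θ)

lemma avg_apply {X S : Type*} [Fintype X] (g : X → Module.End ℝ (S → ℝ)) (h : S → ℝ) (s : S) :
    avg g h s = avg fun x => g x h s := by
  simp [avg, LinearMap.sum_apply, Finset.sum_apply]

lemma represents_circuitMat {r : ℕ} {c : Fin r → Fin b → Fin b}
    (hc : ∀ t, Function.Involutive (c t)) (L : ℕ) (θ : ParamT b m r L) :
    Represents (circuitMat b m r L c θ)
      ((List.ofFn fun l => (List.ofFn fun t => stepOp (c t) (θ.1 l t)).prod).prod *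
        monoOp id (blockPolar θ.2)) :=
  (represents_iqpMat θ.2).mul <| Represents.seqProd fun l => Represents.seqProd fun t =>
    represents_stepMat (hc t) (θ.1 l t)

lemma xeb_eq {r : ℕ} {c : Fin r → Fin b → Fin b} (hc : ∀ t, Function.Involutive (c t)) (L : ℕ) :
    xeb b m r c L = ((2 : ℝ) ^ (m * b))⁻¹ *
      ∑ s, ((((List.ofFn c).map (transfer (m := m))).prod ^ L) (finalTransfer b m 1)) s - 1 := by
  have hK : avg (fun θ : ParamT b m r L =>
      (List.ofFn fun l => (List.ofFn fun t => stepOp (c t) (θ.1 l t)).prod).prod *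
        monoOp id (blockPolar θ.2)) =
      ((List.ofFn c).map (transfer (m := m))).prod ^ L * finalTransfer b m := by
    rw [avg_prod_mul (fun f : Fin L → Fin r → StepP b m =>
      (List.ofFn fun l => (List.ofFn fun t => stepOp (c t) (f l t)).prod).prod)
      (fun θ => monoOp id (blockPolar θ))]
    rw [avg_pi_prod (fun (_ : Fin L) (f : Fin r → StepP b m) =>
      (List.ofFn fun t => stepOp (c t) (f t)).prod)]
    rw [avg_pi_prod (fun t (p : StepP b m) => stepOp (c t) p), List.ofFn_const,
      List.prod_replicate, List.map_ofFn]
    rfl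
  rw [← Module.End.mul_apply, ← hK]
  simp only [avg_apply]
  rw [xeb, mul_div_assoc', Finset.mul_sum,
    Finset.sum_congr rfl fun θ _ => (represents_circuitMat hc L θ).sum_normSq_sq]
  simp only [avg, smul_eq_mul]
  rw [← Finset.mul_sum, ← Finset.mul_sum, Finset.sum_comm]
  ring

end Circuit

section Blocks

variable {b m : ℕ}

/-- All block polar forms vanish on the pair. -/
def Undetected (s : St b m × St b m) : Prop := ∀ θ : Fin b → BlockIQP m, blockPolar θ s.1 s.2 = 0

/-- Linear dependence of a pair of vectors over the field with two elements. -/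
def Dependent {V : Type*} [Zero V] (s : V × V) : Prop := s.1 = 0 ∨ s.2 = 0 ∨ s.1 = s.2

/-- The restriction of a basis label to one block. -/
def blk (x : St b m) (k : Fin b) : Fin m → B2 := fun j => x (k, j)

lemma Undetected.of_dependent {s : St b m × St b m} (h : Dependent s) : Undetected s := by
  intro θ
  unfold blockPolar
  refine Finset.sum_eq_zero fun k _ => Finset.sum_eq_zero fun p _ => ?_
  rcases h with h | h | h
  · simp [h]
  · simp [h]
  · rw [h, mul_comm (s.2 (k, p.1.2)), CharTwo.add_self_eq_zero, mul_zero]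

lemma dependent_of_minors {v w : Fin m → B2}
    (h : ∀ i j, i < j → v i * w j + v j * w i = 0) : Dependent (v, w) := by
  have h' : ∀ i j, v i * w j = v j * w i := by
    intro i j
    rcases lt_trichotomy i j with hij | rfl | hij
    · exact CharTwo.add_eq_zero.1 (h i j hij)
    · rfl
    · exact (CharTwo.add_eq_zero.1 (h j i hij)).symm
  by_cases hv : v = 0
  · exact Or.inl hv
  by_cases hw : w = 0
  · exact Or.inr (Or.inl hw)
  refine Or.inr (Or.inr (funext fun j => ?_))
  obtain ⟨i, hi⟩ := Function.ne_iff.1 hv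
  obtain ⟨l, hl⟩ := Function.ne_iff.1 hw
  have hi1 : v i = 1 := (B2.eq_zero_or_eq_one _).resolve_left hi
  have hl1 : w l = 1 := (B2.eq_zero_or_eq_one _).resolve_left hl
  have hwi : w i = 1 := by
    refine (B2.eq_zero_or_eq_one _).resolve_left fun h0 => ?_
    have := h' i l
    simp [hi1, hl1, h0] at this
  have := h' i j
  rw [hi1, hwi, one_mul, mul_one] at this
  exact this.symm

lemma Undetected.dependent_blk {s : St b m × St b m} (h : Undetected s) (k : Fin b) :
    Dependent (blk s.1 k, blk s.2 k) := by
  refine dependent_of_minors fun i j hij => ?_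
  have := h (Pi.single k (0, Pi.single ⟨(i, j), hij⟩ 1))
  rw [blockPolar, Finset.sum_eq_single k, Finset.sum_eq_single ⟨(i, j), hij⟩] at this
  · simpa [blk] using this
  · intro p _ hp
    simp [hp]
  · simp
  · intro l _ hl
    simp [hl]
  · simp

/-- The indicator of being nonzero. -/
def nz {V : Type*} [Zero V] [DecidableEq V] (v : V) : B2 := if v = 0 then 0 else 1

/-- The nonvanishing pattern of a pair on a block. -/
def blkType (s : St b m × St b m) (k : Fin b) : B2 × B2 := (nz (blk s.1 k), nz (blk s.2 k))

lemma nz_smul {v : Fin m → B2} (hv : v ≠ 0) (α : B2) : nz (α • v) = α := by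
  rcases B2.eq_zero_or_eq_one α with rfl | rfl <;> simp [nz, hv]

lemma Dependent.exists_eq_smul {x y : Fin m → B2} (h : Dependent (x, y)) (hm : 0 < m) :
    ∃ v : Fin m → B2, v ≠ 0 ∧ x = nz x • v ∧ y = nz y • v := by
  by_cases hx : x = 0
  · by_cases hy : y = 0
    · refine ⟨fun _ => 1, fun h0 => one_ne_zero (congrFun h0 ⟨0, hm⟩), ?_, ?_⟩ <;>
        simp [nz, hx, hy]
    · exact ⟨y, hy, by simp [nz, hx], by simp [nz, hy]⟩
  · refine ⟨x, hx, by simp [nz, hx], ?_⟩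
    by_cases hy : y = 0
    · simp [nz, hy]
    · have hxy : x = y := (h.resolve_left hx).resolve_left hy
      simp [nz, hy, hxy]

lemma exists_dotProduct_eq_one {v w : Fin m → B2} (hv : v ≠ 0) (hw : w ≠ 0) :
    ∃ f : Fin m → B2, f ⬝ᵥ v = 1 ∧ f ⬝ᵥ w = 1 := by
  obtain ⟨i, hi⟩ := Function.ne_iff.1 hv
  obtain ⟨j, hj⟩ := Function.ne_iff.1 hw
  have hi1 : v i = 1 := (B2.eq_zero_or_eq_one _).resolve_left hi
  have hj1 : w j = 1 := (B2.eq_zero_or_eq_one _).resolve_left hj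
  rcases B2.eq_zero_or_eq_one (w i) with hwi | hwi
  · rcases B2.eq_zero_or_eq_one (v j) with hvj | hvj
    · exact ⟨Pi.single i 1 + Pi.single j 1, by simp [add_dotProduct, hi1, hvj],
        by simp [add_dotProduct, hj1, hwi]⟩
    · exact ⟨Pi.single j 1, by simp [hvj], by simp [hj1]⟩
  · exact ⟨Pi.single i 1, by simp [hi1], by simp [hwi]⟩

/-- The general linear group over the field with two elements is transitive on nonzero vectors. -/
lemma exists_generalLinearGroup_mulVec_eq {v w : Fin m → B2} (hv : v ≠ 0) (hw : w ≠ 0) :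
    ∃ A : Matrix.GeneralLinearGroup (Fin m) B2, (A : Matrix (Fin m) (Fin m) B2).mulVec v = w := by
  obtain ⟨f, hfv, hfw⟩ := exists_dotProduct_eq_one hv hw
  have hf : f ⬝ᵥ (w - v) = 0 := by rw [dotProduct_sub, hfv, hfw, sub_self]
  set N := Matrix.vecMulVec (w - v) f with hN
  have hNN : N * N = 0 := by
    rw [hN, Matrix.vecMulVec_mul_vecMulVec, hf, zero_smul, Matrix.vecMulVec_zero]
  have h1 : (1 + N) * (1 - N) = 1 := by noncomm_ring; simp [hNN]
  have h2 : (1 - N) * (1 + N) = 1 := by noncomm_ring; simp [hNN]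
  refine ⟨⟨1 + N, 1 - N, h1, h2⟩, ?_⟩
  change (1 + N).mulVec v = w
  rw [Matrix.add_mulVec, Matrix.one_mulVec, hN, Matrix.vecMulVec_mulVec, hfv]
  simp

lemma smul_add_smul_eq_zero_iff {w w' : Fin m → B2} (hw : w ≠ 0) (hw' : w' ≠ 0) (hne : w ≠ w')
    (α α' : B2) : α • w + α' • w' = 0 ↔ α = 0 ∧ α' = 0 := by
  have hadd : w + w' ≠ 0 := fun h => hne (funext fun i => CharTwo.add_eq_zero.1 (congrFun h i))
  rcases B2.eq_zero_or_eq_one α with rfl | rfl <;>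
    rcases B2.eq_zero_or_eq_one α' with rfl | rfl <;> simp [hw, hw', hadd]

/-- If adding vectors of types `(α, β)` and `(α', β')` in independent directions yields a
dependent pair, then the sum has the type of every nonzero summand. -/
lemma type_of_dependent_sum {w w' : Fin m → B2} (hw : w ≠ 0) (hw' : w' ≠ 0) (hne : w ≠ w')
    {α β α' β' : B2} (h : Dependent (α • w + α' • w', β • w + β' • w')) :
    ((α, β) ≠ 0 → (nz (α • w + α' • w'), nz (β • w + β' • w')) = (α, β)) ∧
    ((α', β') ≠ 0 → (nz (α • w + α' • w'), nz (β • w + β' • w')) = (α', β')) := by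
  have heq : α • w + α' • w' = β • w + β' • w' ↔ α - β = 0 ∧ α' - β' = 0 := by
    rw [← smul_add_smul_eq_zero_iff hw hw' hne, ← sub_eq_zero, sub_smul, sub_smul]
    exact Eq.congr (by abel) rfl
  simp only [Dependent, heq, smul_add_smul_eq_zero_iff hw hw' hne] at h
  simp only [nz, smul_add_smul_eq_zero_iff hw hw' hne]
  clear heq
  revert α β α' β'
  decide

lemma blk_inblockCnot (A : Fin b → Matrix.GeneralLinearGroup (Fin m) B2) (x : St b m)
    (k : Fin b) : blk (inblockCnot b m A x) k =
      (A k : Matrix (Fin m) (Fin m) B2).mulVec (blk x k) := rfl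

lemma blk_cnotPerm_fixed {c : Fin b → Fin b} {d : Fin b → B2} (x : St b m) {u : Fin b}
    (h : c u = u) : blk (cnotPerm b m c d x) u = blk x u := by
  funext j
  simp [blk, cnotPerm_apply, h]

lemma blk_cnotPerm_control {c : Fin b → Fin b} {d : Fin b → B2} (x : St b m) {u : Fin b}
    (h : control c d u = u) : blk (cnotPerm b m c d x) u = blk x u := by
  funext j
  simp [blk, cnotPerm_apply, h]

lemma blk_cnotPerm_target {c : Fin b → Fin b} {d : Fin b → B2} (x : St b m) {u : Fin b}
    (h : c u ≠ u) (h' : control c d u ≠ u) :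
    blk (cnotPerm b m c d x) u = blk x u + blk x (c u) := by
  funext j
  simp [blk, cnotPerm_apply, h, h'.symm]

/-- From an undetected pair, some choice in a step either leads to detection or propagates every
nonzero block type along the matching. -/
lemma exists_step_propagating (hm : 2 ≤ m) {c : Fin b → Fin b} (hc : Function.Involutive c)
    {s : St b m × St b m} (hs : Undetected s) :
    ∃ p, Undetected (stepHom c p s.1, stepHom c p s.2) → ∀ u, blkType s u ≠ 0 →
      blkType (stepHom c p s.1, stepHom c p s.2) u = blkType s u ∧
      blkType (stepHom c p s.1, stepHom c p s.2) (c u) = blkType s u := by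
  choose v hv hv1 hv2 using fun k => (hs.dependent_blk k).exists_eq_smul (by omega)
  let e₀ : Fin m → B2 := Pi.single ⟨0, by omega⟩ 1
  let e₁ : Fin m → B2 := Pi.single ⟨1, by omega⟩ 1
  have he₀ : e₀ ≠ 0 := by simp [e₀]
  have he₁ : e₁ ≠ 0 := by simp [e₁]
  have he : e₀ ≠ e₁ := fun h => by
    have := congrFun h ⟨0, by omega⟩
    simp [e₀, e₁] at this
  let w : Fin b → Fin m → B2 := fun k => if k < c k then e₀ else e₁
  have hw : ∀ k, w k ≠ 0 := fun k => by
    simp only [w]; split_ifs <;> assumption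
  have hww : ∀ k, c k ≠ k → w k ≠ w (c k) := by
    intro k hk
    simp only [w, hc k]
    rcases lt_or_gt_of_ne hk with h | h
    · rw [if_neg h.not_gt, if_pos h]; exact he.symm
    · rw [if_pos h, if_neg h.not_gt]; exact he
  choose A hA using fun k => exists_generalLinearGroup_mulVec_eq (hv k) (hw k)
  let d : Fin b → B2 := fun k => if blkType s k ≠ 0 then 0 else 1
  have hctl : ∀ u, blkType s u ≠ 0 → blkType s (control c d u) ≠ 0 := by
    intro u hu
    by_cases h : blkType s (min u (c u)) = 0
    · have hmax : control c d u = max u (c u) := by simp [control, d, h]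
      rw [hmax]
      rcases le_total u (c u) with h' | h'
      · rw [min_eq_left h'] at h
        exact absurd h hu
      · rwa [max_eq_left h']
    · have hmin : control c d u = min u (c u) := by simp [control, d, h]
      rwa [hmin]
  refine ⟨(A, d), fun hs' u hu => ?_⟩
  have hx : ∀ k, blk (inblockCnot b m A s.1) k = (blkType s k).1 • w k := fun k => by
    rw [blk_inblockCnot, hv1, Matrix.mulVec_smul, hA]; rfl
  have hy : ∀ k, blk (inblockCnot b m A s.2) k = (blkType s k).2 • w k := fun k => by
    rw [blk_inblockCnot, hv2, Matrix.mulVec_smul, hA]; rfl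
  have hdef : ∀ x, stepHom c (A, d) x = cnotPerm b m c d (inblockCnot b m A x) := fun _ => rfl
  have hkeep : ∀ k, c k = k ∨ control c d k = k →
      blkType (stepHom c (A, d) s.1, stepHom c (A, d) s.2) k = blkType s k := by
    intro k hk
    simp only [blkType, hdef]
    rcases hk with hk | hk
    · rw [blk_cnotPerm_fixed _ hk, blk_cnotPerm_fixed _ hk, hx, hy, nz_smul (hw k),
        nz_smul (hw k)]
      rfl
    · rw [blk_cnotPerm_control _ hk, blk_cnotPerm_control _ hk, hx, hy, nz_smul (hw k),
        nz_smul (hw k)]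
      rfl
  have htarget : ∀ k, c k ≠ k → control c d k ≠ k →
      (blkType s k ≠ 0 →
        blkType (stepHom c (A, d) s.1, stepHom c (A, d) s.2) k = blkType s k) ∧
      (blkType s (c k) ≠ 0 →
        blkType (stepHom c (A, d) s.1, stepHom c (A, d) s.2) k = blkType s (c k)) := by
    intro k hk hk'
    have hdep := hs'.dependent_blk k
    simp only [hdef] at hdep
    rw [blk_cnotPerm_target _ hk hk', blk_cnotPerm_target _ hk hk', hx, hx, hy, hy] at hdep
    have := type_of_dependent_sum (hw k) (hw (c k)) (hww k hk) hdep
    simp only [hdef]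
    rw [blkType.eq_def (cnotPerm _ _ _ _ _, _), blk_cnotPerm_target _ hk hk', blk_cnotPerm_target _ hk hk', hx, hx, hy, hy]
    exact this
  by_cases hcu : c u = u
  · rw [hcu]
    exact ⟨hkeep u (Or.inl hcu), hkeep u (Or.inl hcu)⟩
  have hccu : c (c u) ≠ c u := fun h => hcu (hc.injective h)
  by_cases hctlu : control c d u = u
  · have h1 : control c d (c u) ≠ c u := by
      rw [control_partner hc, hctlu]
      exact Ne.symm hcu
    have := (htarget (c u) hccu h1).2
    rw [hc u] at this
    exact ⟨hkeep u (Or.inr hctlu), this hu⟩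
  · have h1 : control c d u = c u := (control_eq_or c d u).resolve_left hctlu
    have h2 := hctl u hu
    rw [h1] at h2
    have h3 := htarget u hcu hctlu
    refine ⟨h3.1 hu, ?_⟩
    rw [hkeep (c u) (Or.inr (by rw [control_partner hc, h1])), ← h3.2 h2, h3.1 hu]

end Blocks

section RealAverage

variable {X : Type*} [Fintype X] [Nonempty X]

lemma avg_const (r : ℝ) : avg (fun _ : X => r) = r := by
  have : (Fintype.card X : ℝ) ≠ 0 := by exact_mod_cast Fintype.card_ne_zero
  simp [avg, this]

lemma avg_mono {g g' : X → ℝ} (h : ∀ x, g x ≤ g' x) : avg g ≤ avg g' := by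
  unfold avg
  exact smul_le_smul_of_nonneg_left (Finset.sum_le_sum fun x _ => h x) (by positivity)

lemma eq_of_le_avg {g : X → ℝ} {M : ℝ} (h : ∀ x, g x ≤ M) (hM : M ≤ avg g) (x : X) :
    g x = M := by
  by_contra hne
  have hcard : (0 : ℝ) < Fintype.card X := by exact_mod_cast Fintype.card_pos
  have hlt : ∑ x, g x < ∑ _x : X, M :=
    Finset.sum_lt_sum (fun x _ => h x) ⟨x, Finset.mem_univ x, lt_of_le_of_ne (h x) hne⟩
  have : avg g < avg fun _ : X => M := by
    unfold avg
    exact smul_lt_smul_of_pos_left hlt (by positivity)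
  rw [avg_const] at this
  linarith

end RealAverage

section Dynamics

variable {b m : ℕ}

/-- `blockPolar` as a homomorphism in the circuit parameters. -/
def polarHom (s : St b m × St b m) : (Fin b → BlockIQP m) →+ B2 where
  toFun θ := blockPolar θ s.1 s.2
  map_zero' := by simp [blockPolar]
  map_add' θ θ' := by simp [blockPolar, add_mul, Finset.sum_add_distrib]

/-- The indicator function of undetected pairs. -/
noncomputable def undet (s : St b m × St b m) : ℝ :=
  open Classical in if Undetected s then 1 else 0

lemma undet_of {s : St b m × St b m} (h : Undetected s) : undet s = 1 := if_pos h

lemma undet_of_not {s : St b m × St b m} (h : ¬ Undetected s) : undet s = 0 := if_neg h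

lemma undet_nonneg (s : St b m × St b m) : 0 ≤ undet s := by
  unfold undet; split_ifs <;> norm_num

lemma undet_le_one (s : St b m × St b m) : undet s ≤ 1 := by
  unfold undet; split_ifs <;> norm_num

lemma avg_sgnR_blockPolar (s : St b m × St b m) :
    avg (fun θ : Fin b → BlockIQP m => sgnR (blockPolar θ s.1 s.2)) = undet s := by
  have := sum_sgnR_hom (polarHom s)
  have hcard : (Fintype.card (Fin b → BlockIQP m) : ℝ) ≠ 0 := by
    exact_mod_cast Fintype.card_ne_zero
  rw [avg]
  change _ • ∑ θ, sgnR (polarHom s θ) = _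
  rw [this]
  by_cases h : Undetected s
  · rw [undet_of h, if_pos (show ∀ θ, polarHom s θ = 0 from h), smul_eq_mul, inv_mul_cancel₀ hcard]
  · rw [undet_of_not h, if_neg (show ¬ ∀ θ, polarHom s θ = 0 from h), smul_zero]

lemma finalTransfer_one : finalTransfer b m 1 = undet := by
  funext s
  rw [finalTransfer, avg_apply, ← avg_sgnR_blockPolar]
  simp [monoOp_apply]

lemma transfer_apply (c : Fin b → Fin b) (h : St b m × St b m → ℝ) (s : St b m × St b m) :
    transfer c h s = undet s * avg fun p => h (stepHom c p s.1, stepHom c p s.2) := by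
  rw [transfer, avg_apply, ← avg_sgnR_blockPolar, ← avg_prod_mul]
  rfl

lemma transfer_mono (c : Fin b → Fin b) {h h' : St b m × St b m → ℝ} (hh : h ≤ h') :
    transfer c h ≤ transfer c h' := by
  intro s
  rw [transfer_apply, transfer_apply]
  exact mul_le_mul_of_nonneg_left (avg_mono fun p => hh _) (undet_nonneg s)

lemma transfer_nonneg (c : Fin b → Fin b) {h : St b m × St b m → ℝ} (hh : 0 ≤ h) :
    0 ≤ transfer c h := by
  simpa using transfer_mono c hh

lemma transfer_le_undet (c : Fin b → Fin b) {h : St b m × St b m → ℝ} (hh : h ≤ undet) :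
    transfer c h ≤ undet := by
  intro s
  rw [transfer_apply]
  refine mul_le_of_le_one_right (undet_nonneg s) ?_
  calc _ ≤ avg fun _ => (1 : ℝ) := avg_mono fun p => (hh _).trans (undet_le_one _)
    _ = 1 := avg_const _

lemma transfer_eq_one (c : Fin b → Fin b) {h : St b m × St b m → ℝ}
    (hh : ∀ s, Dependent s → h s = 1) : ∀ s, Dependent s → transfer c h s = 1 := by
  intro s hs
  have : ∀ p, h (stepHom c p s.1, stepHom c p s.2) = 1 := by
    refine fun p => hh _ ?_
    rcases hs with hs | hs | hs
    · exact Or.inl (by simp [hs])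
    · exact Or.inr (Or.inl (by simp [hs]))
    · exact Or.inr (Or.inr (by simp [hs]))
  simp only [transfer_apply, undet_of (Undetected.of_dependent hs), this, avg_const, mul_one]

lemma not_dependent_stepHom {c : Fin b → Fin b} (hc : Function.Involutive c)
    (p : (Fin b → Matrix.GeneralLinearGroup (Fin m) B2) × (Fin b → B2))
    {s : St b m × St b m} (hs : ¬ Dependent s) :
    ¬ Dependent (stepHom c p s.1, stepHom c p s.2) := by
  have hi := stepHom_injective hc p
  simpa only [Dependent, map_eq_zero_iff _ hi, hi.eq_iff] using hs

lemma transfer_le_of_le {c : Fin b → Fin b} (hc : Function.Involutive c)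
    {h : St b m × St b m → ℝ} {M : ℝ} (hM : 0 ≤ M) (hh : ∀ s, ¬ Dependent s → h s ≤ M) :
    ∀ s, ¬ Dependent s → transfer c h s ≤ M := by
  intro s hs
  rw [transfer_apply]
  calc _ ≤ undet s * avg fun _ => M := mul_le_mul_of_nonneg_left
        (avg_mono fun p => hh _ (not_dependent_stepHom hc p hs)) (undet_nonneg s)
    _ ≤ M := by
        rw [avg_const]
        exact mul_le_of_le_one_left hM (undet_le_one s)

/-- A property preserved by every factor is preserved by the product. -/
lemma list_prod_transfer_induction {l : List (Fin b → Fin b)}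
    {P : (St b m × St b m → ℝ) → Prop} (hP : ∀ c ∈ l, ∀ h, P h → P (transfer c h))
    {h : St b m × St b m → ℝ} (hh : P h) : P ((l.map transfer).prod h) := by
  induction l with
  | nil => simpa using hh
  | cons c l ih =>
    simp only [List.map_cons, List.prod_cons, Module.End.mul_apply]
    exact hP c List.mem_cons_self _ (ih fun c' hc' => hP c' (List.mem_cons_of_mem _ hc'))

lemma list_prod_transfer_mono (l : List (Fin b → Fin b)) {h h' : St b m × St b m → ℝ}
    (hh : h ≤ h') : (l.map transfer).prod h ≤ (l.map transfer).prod h' := by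
  induction l with
  | nil => simpa using hh
  | cons c l ih =>
    simp only [List.map_cons, List.prod_cons, Module.End.mul_apply]
    exact transfer_mono c ih

/-- If the maximum `M` of `h` over independent pairs is attained by the evolved function at `s`,
then it is attained by `h` at a pair to which all nonzero block types of `s` have propagated. -/
lemma exists_propagated_of_eq (hm : 2 ≤ m) {h : St b m × St b m → ℝ} {M : ℝ} (hM : 0 < M)
    (hu : h ≤ undet) (hle : ∀ s, ¬ Dependent s → h s ≤ M) {l : List (Fin b → Fin b)}
    (hl : ∀ c ∈ l, Function.Involutive c) {s : St b m × St b m} (hs : ¬ Dependent s)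
    (hsM : (l.map transfer).prod h s = M) :
    ∃ s', ¬ Dependent s' ∧ h s' = M ∧ ∀ u, blkType s u ≠ 0 →
      blkType s' u = blkType s u ∧ ∀ c ∈ l, blkType s' (c u) = blkType s u := by
  induction l generalizing s with
  | nil => exact ⟨s, hs, by simpa using hsM, fun u _ => ⟨rfl, by simp⟩⟩
  | cons c l ih =>
    have hc := hl c List.mem_cons_self
    have hl' : ∀ c ∈ l, Function.Involutive c := fun c' hc' => hl c' (List.mem_cons_of_mem _ hc')
    set g := (l.map transfer).prod h with hg
    have hgu : g ≤ undet :=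
      list_prod_transfer_induction (P := fun g => g ≤ undet)
        (fun c _ _ hh => transfer_le_undet c hh) hu
    have hgM : ∀ s, ¬ Dependent s → g s ≤ M :=
      list_prod_transfer_induction (P := fun g => ∀ s, ¬ Dependent s → g s ≤ M)
        (fun c hc _ hh => transfer_le_of_le (hl' c hc) hM.le hh) hle
    rw [List.map_cons, List.prod_cons, Module.End.mul_apply, ← hg, transfer_apply] at hsM
    have hsu : Undetected s := by
      by_contra hsu
      rw [undet_of_not hsu, zero_mul] at hsM
      exact hM.ne hsM
    rw [undet_of hsu, one_mul] at hsM
    have hall := eq_of_le_avg (fun p => hgM _ (not_dependent_stepHom hc p hs)) hsM.ge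
    obtain ⟨p, hp⟩ := exists_step_propagating hm hc hsu
    have hdet : Undetected (stepHom c p s.1, stepHom c p s.2) := by
      by_contra hdet
      have := hgu (stepHom c p s.1, stepHom c p s.2)
      rw [hall p, undet_of_not hdet] at this
      exact this.not_gt hM
    obtain ⟨s', hs', hs'M, htype⟩ := ih hl' (not_dependent_stepHom hc p hs) (hall p)
    refine ⟨s', hs', hs'M, fun u hu => ?_⟩
    obtain ⟨h1, h2⟩ := hp hdet u hu
    obtain ⟨h3, h4⟩ := htype u (h1 ▸ hu)
    refine ⟨h3.trans h1, fun c' hc' => ?_⟩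
    rcases List.mem_cons.1 hc' with rfl | hc'
    · rw [(htype (c' u) (h2 ▸ hu)).1, h2]
    · rw [h4 c' hc', h1]

lemma exists_blkType_ne_zero {s : St b m × St b m} (h : s.1 ≠ 0) : ∃ u, blkType s u ≠ 0 := by
  obtain ⟨q, hq⟩ := Function.ne_iff.1 h
  refine ⟨q.1, fun h0 => ?_⟩
  have h1 : nz (blk s.1 q.1) = 0 := congrArg Prod.fst h0
  have h2 : blk s.1 q.1 = 0 := by
    by_contra hne
    simp [nz, hne] at h1
  exact hq (congrFun h2 q.2)

lemma nz_eq_zero_iff {V : Type*} [Zero V] [DecidableEq V] (v : V) : nz v = 0 ↔ v = 0 := by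
  by_cases h : v = 0 <;> simp [nz, h]

/-- An undetected pair with the same type on all blocks is dependent. -/
lemma dependent_of_blkType_const {s : St b m × St b m} (hs : Undetected s) {t : B2 × B2}
    (ht : ∀ u, blkType s u = t) : Dependent s := by
  have h1 : ∀ u, blk s.1 u = 0 ↔ t.1 = 0 := fun u => by
    rw [← ht u]; exact (nz_eq_zero_iff _).symm
  have h2 : ∀ u, blk s.2 u = 0 ↔ t.2 = 0 := fun u => by
    rw [← ht u]; exact (nz_eq_zero_iff _).symm
  by_cases h1' : t.1 = 0
  · exact Or.inl (funext fun q => congrFun ((h1 q.1).2 h1') q.2)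
  by_cases h2' : t.2 = 0
  · exact Or.inr (Or.inl (funext fun q => congrFun ((h2 q.1).2 h2') q.2))
  refine Or.inr (Or.inr (funext fun q => ?_))
  have := ((hs.dependent_blk q.1).resolve_left fun h => h1' ((h1 q.1).1 h)).resolve_left
    fun h => h2' ((h2 q.1).1 h)
  exact congrFun this q.2

/-- A fixed point of the hyperlayer operator below `undet` is nonpositive on independent pairs. -/
lemma fixedPoint_nonpos {r : ℕ} (hm : 2 ≤ m) {c : Fin r → Fin b → Fin b}
    (hc : ∀ t, Function.Involutive (c t))
    (hconn : (SimpleGraph.fromRel fun u v : Fin b => ∃ t, c t u = v).Connected)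
    {h : St b m × St b m → ℝ} (hu : h ≤ undet)
    (hfix : ((List.ofFn c).map transfer).prod h = h) {s : St b m × St b m}
    (hs : ¬ Dependent s) : h s ≤ 0 := by
  classical
  obtain ⟨s₀, hs₀, hmax⟩ := Finset.exists_max_image
    (Finset.univ.filter fun s : St b m × St b m => ¬ Dependent s) h ⟨s, by simpa using hs⟩
  simp only [Finset.mem_filter, Finset.mem_univ, true_and] at hs₀ hmax
  refine (hmax s hs).trans (not_lt.1 fun hpos => ?_)
  obtain ⟨s₁, hs₁, hcount⟩ := Finset.exists_max_image
    (Finset.univ.filter fun s : St b m × St b m => ¬ Dependent s ∧ h s = h s₀)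
    (fun s => (Finset.univ.filter fun u => blkType s u ≠ 0).card) ⟨s₀, by simpa using hs₀⟩
  simp only [Finset.mem_filter, Finset.mem_univ, true_and] at hs₁ hcount
  obtain ⟨s₂, hs₂, hs₂M, htype⟩ := exists_propagated_of_eq hm hpos hu hmax
    (l := List.ofFn c) (by simpa [List.mem_ofFn] using hc) hs₁.1 (by rw [hfix, hs₁.2])
  have hsub : (Finset.univ.filter fun u => blkType s₁ u ≠ 0) ⊆
      Finset.univ.filter fun u => blkType s₂ u ≠ 0 := by
    intro u
    simp only [Finset.mem_filter, Finset.mem_univ, true_and]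
    intro hu
    rw [(htype u hu).1]
    exact hu
  have heq := Finset.eq_of_subset_of_card_le hsub (hcount s₂ ⟨hs₂, hs₂M⟩)
  have hstep : ∀ u, blkType s₁ u ≠ 0 → ∀ t, blkType s₁ (c t u) = blkType s₁ u := by
    intro u hu t
    have h1 := (htype u hu).2 (c t) (by simp [List.mem_ofFn])
    have h2 : c t u ∈ Finset.univ.filter fun u => blkType s₁ u ≠ 0 := by
      rw [heq]
      simpa [h1] using hu
    rw [← (htype (c t u) (by simpa using h2)).1, h1]
  obtain ⟨u₀, hu₀⟩ := exists_blkType_ne_zero (s := s₁) fun h0 => hs₁.1 (Or.inl h0)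
  have hconst : ∀ u, blkType s₁ u = blkType s₁ u₀ := by
    intro u
    obtain ⟨w⟩ := hconn.preconnected u u₀
    induction w with
    | nil => rfl
    | @cons x y z hadj _ ih =>
      have hy := ih hu₀
      rw [SimpleGraph.fromRel_adj] at hadj
      obtain ⟨t, ht⟩ : ∃ t, c t y = x := by
        rcases hadj.2 with ⟨t, ht⟩ | ⟨t, ht⟩
        · exact ⟨t, by rw [← ht, hc t]⟩
        · exact ⟨t, ht⟩
      rw [← ht, hstep y (hy ▸ hu₀) t, hy]
  have hundet : Undetected s₁ := by
    by_contra hn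
    have := hu s₁
    rw [undet_of_not hn, hs₁.2] at this
    exact this.not_gt hpos
  exact hs₁.1 (dependent_of_blkType_const hundet hconst)

/-- The iterates of the hyperlayer operator converge to the indicator of dependent pairs. -/
lemma tendsto_iterate {r : ℕ} (hm : 2 ≤ m) {c : Fin r → Fin b → Fin b}
    (hc : ∀ t, Function.Involutive (c t))
    (hconn : (SimpleGraph.fromRel fun u v : Fin b => ∃ t, c t u = v).Connected)
    [DecidablePred (Dependent (V := St b m))] :
    Filter.Tendsto (fun L => (((List.ofFn c).map (transfer (m := m))).prod ^ L) undet)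
      Filter.atTop (nhds fun s => if Dependent s then 1 else 0) := by
  set T := ((List.ofFn c).map (transfer (m := m))).prod with hT
  have hsucc : ∀ L, (T ^ (L + 1)) undet = T ((T ^ L) undet) := fun L => by
    rw [pow_succ', Module.End.mul_apply]
  have hnonneg : ∀ L, 0 ≤ (T ^ L) undet := by
    intro L
    induction L with
    | zero => exact fun s => undet_nonneg s
    | succ L ih =>
      rw [hsucc]
      exact list_prod_transfer_induction (fun c _ _ hh => transfer_nonneg c hh) ih
  have hle : ∀ L, (T ^ L) undet ≤ undet := by
    intro L
    induction L with
    | zero => exact le_rfl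
    | succ L ih =>
      rw [hsucc]
      exact list_prod_transfer_induction (P := fun g => g ≤ undet)
        (fun c _ _ hh => transfer_le_undet c hh) ih
  have hone : ∀ L, ∀ s, Dependent s → (T ^ L) undet s = 1 := by
    intro L
    induction L with
    | zero => exact fun s hs => undet_of (Undetected.of_dependent hs)
    | succ L ih =>
      rw [hsucc]
      exact list_prod_transfer_induction (P := fun g => ∀ s, Dependent s → g s = 1)
        (fun c _ _ hh => transfer_eq_one c hh) ih
  have hanti : Antitone fun L => (T ^ L) undet := by
    refine antitone_nat_of_succ_le fun L => ?_
    induction L with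
    | zero => exact hle 1
    | succ L ih =>
      rw [hsucc (L + 1)]
      nth_rw 2 [hsucc L]
      exact list_prod_transfer_mono _ ih
  have hlim : Filter.Tendsto (fun L => (T ^ L) undet) Filter.atTop
      (nhds fun s => ⨅ L, (T ^ L) undet s) := by
    refine tendsto_pi_nhds.2 fun s => tendsto_atTop_ciInf (fun L L' hL => hanti hL s) ?_
    exact ⟨0, by rintro _ ⟨L, rfl⟩; exact hnonneg L s⟩
  set h : St b m × St b m → ℝ := fun s => ⨅ L, (T ^ L) undet s with hh
  have hfix : T h = h := by
    have h1 := ((LinearMap.continuous_of_finiteDimensional T).tendsto h).comp hlim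
    have h2 := hlim.comp (Filter.tendsto_add_atTop_nat 1)
    refine tendsto_nhds_unique h1 (h2.congr fun L => ?_)
    exact hsucc L
  have hhu : h ≤ undet := le_of_tendsto' hlim hle
  have hhn : 0 ≤ h := ge_of_tendsto' hlim hnonneg
  have : h = fun s => if Dependent s then 1 else 0 := by
    funext s
    split_ifs with hs
    · simp only [hh, hone _ s hs, ciInf_const]
    · exact le_antisymm (fixedPoint_nonpos hm hc hconn hhu hfix hs) (hhn s)
  rw [← this]
  exact hlim

lemma sum_dependent {V : Type*} [Zero V] [Fintype V] [DecidableEq V]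
    [DecidablePred (Dependent (V := V))] :
    ∑ s : V × V, (if Dependent s then (1 : ℝ) else 0) = 3 * Fintype.card V - 2 := by
  have : ∀ x y : V, (if Dependent (x, y) then (1 : ℝ) else 0) =
      (if x = 0 then 1 else 0) + (if y = 0 then 1 else 0) + (if x = y then 1 else 0) -
        2 * (if y = 0 then (if x = 0 then 1 else 0) else 0) := by
    intro x y
    simp only [Dependent]
    by_cases hx : x = 0 <;> by_cases hy : y = 0 <;> by_cases hxy : x = y <;>
      simp_all
    norm_num
  have hrow : ∑ x : V, ∑ _y : V, (if x = 0 then (1 : ℝ) else 0) = Fintype.card V := by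
    rw [Finset.sum_comm]
    simp
  simp only [Fintype.sum_prod_type, this, hrow, Finset.sum_add_distrib, Finset.sum_sub_distrib,
    ← Finset.mul_sum, Finset.sum_ite_eq', Finset.sum_ite_eq, Finset.mem_univ, if_true,
    Finset.sum_const, Finset.card_univ, nsmul_eq_mul, mul_one]
  ring

end Dynamics

/-- (Asymptotic XEB of block-random IQP circuits with uniform in-block
CNOT circuits; anticoncentration of deep hypercube IQP circuits.)  Let `m ≥ 2`.  For
every connected graph on `b` blocks presented by an ordered partition of its edge set
into matchings, the ideal XEB score of the hyperdepth-`L` block-random degree-2 IQP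
ensemble with randomized parallel transversal CNOTs and independent uniformly random
in-block CNOT circuits converges, as `L → ∞`, to the uniform-IQP value
`2 − 2^{1−m·b}`. -/
theorem xeb_blockRandom_inblockCnot_tendsto (b m r : ℕ) (hb : 1 ≤ b) (hm : 2 ≤ m)
    (c : Fin r → Fin b → Fin b)
    (hinv : ∀ t, Function.Involutive (c t))
    (hpart : ∀ t t' : Fin r, t ≠ t' → ∀ u, c t u ≠ u → c t' u ≠ c t u)
    (hconn : (SimpleGraph.fromRel fun u v : Fin b => ∃ t, c t u = v).Connected) :
    Filter.Tendsto (fun L => xeb b m r c L) Filter.atTop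
      (nhds (2 - 2 * ((2 : ℝ) ^ (m * b))⁻¹)) := by
  classical
  have h := tendsto_iterate hm hinv hconn
  have h1 : Filter.Tendsto (fun L => ∑ s, (((List.ofFn c).map (transfer (m := m))).prod ^ L)
      undet s) Filter.atTop (nhds (∑ s : St b m × St b m, if Dependent s then 1 else 0)) :=
    tendsto_finsetSum _ fun s _ => tendsto_pi_nhds.1 h s
  have h2 := (h1.const_mul ((2 : ℝ) ^ (m * b))⁻¹).sub_const 1
  simp only [xeb_eq hinv, finalTransfer_one]
  convert h2 using 2
  rw [sum_dependent, card_St]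
  push_cast
  have : (2 : ℝ) ^ (m * b) ≠ 0 := by positivity
  field_simp
  ring

end Stmt9
end

section
/- (XEB equals twice fidelity for a random final IQP layer.) Let n ≥ 1, let G : 𝔽₂ⁿ → 𝔽₂ be arbitrary, and let σ be a positive semidefinite Hermitian 2ⁿ×2ⁿ matrix with p := tr σ > 0. For a uniformly random degree-2 polynomial f, define the ideal state |ψ_f⟩ = U_{G+f}|+ⁿ⟩, the noisy state ρ_f = U_f σ U_f†, the fidelity F(f) = ⟨ψ_f| ρ_f |ψ_f⟩ / p, and the XEB score χ(f) = (2ⁿ/p) Σ_{x∈𝔽₂ⁿ} |⟨x|H^{⊗n}|ψ_f⟩|² · ⟨x|H^{⊗n} ρ_f H^{⊗n}|x⟩ − 1. Then E_f[χ(f)] = 2·E_f[F(f)] − 2^(1−n). -/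
open scoped BigOperators ComplexOrder
open Matrix

namespace Stmt10

/-- Computational basis labels for `n` qubits: `𝔽₂ⁿ`. -/
abbrev QState (n : ℕ) := Fin n → ZMod 2

/-- Index pairs `i < j` of qubits. -/
abbrev PairIdx (n : ℕ) := {p : Fin n × Fin n // p.1 < p.2}

/-- `(-1)^a` as a complex number. -/
def sgn (a : ZMod 2) : ℂ := (-1 : ℂ) ^ a.val

/-- Parameters of a uniformly random degree-2 polynomial. -/
abbrev Param (n : ℕ) := QState n × (PairIdx n → ZMod 2)

/-- The degree-2 polynomial `f(z) = Σ_{i<j} b_{ij} z_i z_j + Σ_i a_i z_i` over `𝔽₂`. -/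
def deg2 {n : ℕ} (θ : Param n) (z : QState n) : ZMod 2 :=
  (∑ p : PairIdx n, θ.2 p * z p.1.1 * z p.1.2) + ∑ i, θ.1 i * z i

/-- The diagonal unitary `U_f|x⟩ = (−1)^{f(x)}|x⟩`. -/
noncomputable def Uf {n : ℕ} (f : QState n → ZMod 2) : Matrix (QState n) (QState n) ℂ :=
  Matrix.diagonal fun x => sgn (f x)

/-- The uniform superposition `|+ⁿ⟩`. -/
noncomputable def plusV (n : ℕ) : QState n → ℂ := fun _ => (((Real.sqrt 2)⁻¹ : ℝ) ^ n : ℝ)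

/-- The `n`-fold Hadamard. -/
noncomputable def Hmat (n : ℕ) : Matrix (QState n) (QState n) ℂ :=
  Matrix.of fun x y => (((Real.sqrt 2)⁻¹ : ℝ) ^ n : ℝ) * sgn (∑ i, x i * y i)

/-- The ideal state `|ψ_f⟩ = U_{G+f}|+ⁿ⟩`. -/
noncomputable def ψ {n : ℕ} (G : QState n → ZMod 2) (θ : Param n) : QState n → ℂ :=
  (Uf fun z => G z + deg2 θ z).mulVec (plusV n)

/-- The noisy state `ρ_f = U_f σ U_f†`. -/
noncomputable def ρnoisy {n : ℕ} (σ : Matrix (QState n) (QState n) ℂ) (θ : Param n) :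
    Matrix (QState n) (QState n) ℂ :=
  Uf (deg2 θ) * σ * (Uf (deg2 θ))ᴴ

/-- The fidelity `F(f) = ⟨ψ_f|ρ_f|ψ_f⟩ / p`. -/
noncomputable def Fid {n : ℕ} (G : QState n → ZMod 2) (σ : Matrix (QState n) (QState n) ℂ)
    (p : ℝ) (θ : Param n) : ℂ :=
  (∑ x : QState n, (starRingEnd ℂ) (ψ G θ x) * ((ρnoisy σ θ).mulVec (ψ G θ)) x) / (p : ℂ)

/-- The XEB score
`χ(f) = (2ⁿ/p) Σ_x |⟨x|H^{⊗n}|ψ_f⟩|² ⟨x|H^{⊗n} ρ_f H^{⊗n}|x⟩ − 1`. -/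
noncomputable def Xeb {n : ℕ} (G : QState n → ZMod 2) (σ : Matrix (QState n) (QState n) ℂ)
    (p : ℝ) (θ : Param n) : ℂ :=
  (2 : ℂ) ^ n / (p : ℂ) *
    ∑ x : QState n,
      (Complex.normSq (((Hmat n).mulVec (ψ G θ)) x) : ℂ) *
        ((Hmat n * ρnoisy σ θ * Hmat n) x x) - 1

/-! ### Signs -/

lemma sgn_zero : sgn 0 = 1 := by simp [sgn]

lemma sgn_one : sgn 1 = -1 := by simp [sgn, ZMod.val_one]

lemma eq_zero_or_eq_one (a : ZMod 2) : a = 0 ∨ a = 1 := by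
  revert a
  decide

lemma sgn_add (a b : ZMod 2) : sgn (a + b) = sgn a * sgn b := by
  rcases eq_zero_or_eq_one a with rfl | rfl <;> rcases eq_zero_or_eq_one b with rfl | rfl <;>
    simp [sgn_zero, sgn_one, CharTwo.add_self_eq_zero]

lemma sgn_mul_self (a : ZMod 2) : sgn a * sgn a = 1 := by
  rw [← sgn_add, CharTwo.add_self_eq_zero, sgn_zero]

lemma conj_sgn (a : ZMod 2) : (starRingEnd ℂ) (sgn a) = sgn a := by
  simp [sgn]

lemma sgn_of_ne_zero {a : ZMod 2} (h : a ≠ 0) : sgn a = -1 := by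
  rw [(eq_zero_or_eq_one a).resolve_left h, sgn_one]

/-- The character of an additive map to `𝔽₂` that is not identically zero sums to zero. -/
lemma sum_sgn_eq_zero {A : Type*} [AddGroup A] [Fintype A] (L : A → ZMod 2)
    (hL : ∀ s t, L (s + t) = L s + L t) (t : A) (ht : L t ≠ 0) : ∑ s, sgn (L s) = 0 := by
  have h : ∑ s, sgn (L s) = ∑ s, sgn (L (s + t)) :=
    (Equiv.sum_comp (Equiv.addRight t) fun s => sgn (L s)).symm
  simp only [hL, sgn_add, sgn_of_ne_zero ht, mul_neg, mul_one, Finset.sum_neg_distrib] at h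
  exact self_eq_neg.mp h

/-! ### Fourth moments of random degree-2 phases -/

lemma deg2_add {n : ℕ} (s t : Param n) (z : QState n) :
    deg2 (s + t) z = deg2 s z + deg2 t z := by
  simp only [deg2, Prod.fst_add, Prod.snd_add, Pi.add_apply, add_mul, Finset.sum_add_distrib]
  ring

lemma deg2_single_linear {n : ℕ} (i : Fin n) (z : QState n) :
    deg2 ((Pi.single i 1, 0) : Param n) z = z i := by
  simp [deg2, Pi.single_apply]

lemma deg2_single_pair {n : ℕ} (q : PairIdx n) (z : QState n) :
    deg2 ((0, Pi.single q 1) : Param n) z = z q.1.1 * z q.1.2 := by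
  simp [deg2, Pi.single_apply, ite_mul]

/-- Two proportional vectors over `𝔽₂` are equal unless one of them vanishes. -/
lemma eq_zero_or_eq_zero_or_eq {ι : Type*} {a b : ι → ZMod 2}
    (h : ∀ i j, a i * b j = a j * b i) : a = 0 ∨ b = 0 ∨ a = b := by
  have dec : ∀ u : ZMod 2, u ≠ 0 → u = 1 := fun u => (eq_zero_or_eq_one u).resolve_left
  by_cases ha : a = 0
  · exact Or.inl ha
  by_cases hb : b = 0
  · exact Or.inr (Or.inl hb)
  obtain ⟨i, hi⟩ := Function.ne_iff.mp ha
  obtain ⟨j, hj⟩ := Function.ne_iff.mp hb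
  have hi1 := dec _ hi
  have hbi : b i = 1 := by
    refine dec _ fun h0 => hj ?_
    simpa [hi1, h0] using h i j
  refine Or.inr (Or.inr (funext fun k => ?_))
  simpa [hi1, hbi] using (h i k).symm

/-- The four points split into two pairs of equal points. -/
abbrev Paired {α : Type*} (z z' y w : α) : Prop :=
  (z = z' ∧ y = w) ∨ (z = y ∧ z' = w) ∨ (z = w ∧ z' = y)

lemma paired_of_deg2_sum_eq_zero {n : ℕ} {z z' y w : QState n}
    (h : ∀ θ : Param n, deg2 θ z + deg2 θ z' + deg2 θ y + deg2 θ w = 0) :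
    Paired z z' y w := by
  have hlin : ∀ i, z i + z' i + y i + w i = 0 := fun i => by
    simpa only [deg2_single_linear] using h (Pi.single i 1, 0)
  have hlt : ∀ i j, i < j → (z i + z' i) * (z j + y j) = (z j + z' j) * (z i + y i) := by
    intro i j hij
    have hq := h (0, Pi.single ⟨(i, j), hij⟩ 1)
    simp only [deg2_single_pair] at hq
    have hi := hlin i
    have hj := hlin j
    generalize z i = z₁ at *
    generalize z j = z₂ at *
    generalize z' i = x₁ at *
    generalize z' j = x₂ at *
    generalize y i = y₁ at *
    generalize y j = y₂ at *
    generalize w i = w₁ at *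
    generalize w j = w₂ at *
    obtain rfl : w₁ = z₁ + x₁ + y₁ := (CharTwo.add_eq_zero.mp hi).symm
    obtain rfl : w₂ = z₂ + x₂ + y₂ := (CharTwo.add_eq_zero.mp hj).symm
    clear hi hj h hlin
    revert z₁ z₂ x₁ x₂ y₁ y₂
    decide
  have hw : w = z + z' + y := funext fun i => (CharTwo.add_eq_zero.mp (hlin i)).symm
  have key := eq_zero_or_eq_zero_or_eq (a := z + z') (b := z + y) fun i j => by
    rcases lt_trichotomy i j with hij | rfl | hij
    · exact hlt i j hij
    · rfl
    · exact (hlt j i hij).symm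
  have eq_of_add : ∀ {u v : QState n}, u + v = 0 → u = v := fun {u v} huv =>
    funext fun i => CharTwo.add_eq_zero.mp (congrFun huv i)
  have self_add : ∀ u : QState n, u + u = 0 := fun u =>
    funext fun i => CharTwo.add_self_eq_zero (u i)
  rcases key with ha | hb | hab
  · exact Or.inl ⟨eq_of_add ha, by rw [hw, ha, zero_add]⟩
  · refine Or.inr (Or.inl ⟨eq_of_add hb, ?_⟩)
    rw [hw, add_right_comm, hb, zero_add]
  · have hzy : z' = y := add_left_cancel hab
    refine Or.inr (Or.inr ⟨?_, hzy⟩)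
    rw [hw, hzy, add_assoc, self_add, add_zero]

lemma sum_sgn_deg2_four {n : ℕ} (z z' y w : QState n) :
    ∑ θ : Param n, sgn (deg2 θ z) * sgn (deg2 θ z') * sgn (deg2 θ y) * sgn (deg2 θ w) =
      Fintype.card (Param n) * if Paired z z' y w then 1 else 0 := by
  split_ifs with hP
  · have h1 : ∀ θ : Param n,
        sgn (deg2 θ z) * sgn (deg2 θ z') * sgn (deg2 θ y) * sgn (deg2 θ w) = 1 := by
      intro θ
      rcases hP with ⟨rfl, rfl⟩ | ⟨rfl, rfl⟩ | ⟨rfl, rfl⟩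
      · rw [sgn_mul_self, one_mul, sgn_mul_self]
      · linear_combination sgn (deg2 θ z') * sgn (deg2 θ z') * sgn_mul_self (deg2 θ z) +
          sgn_mul_self (deg2 θ z')
      · linear_combination sgn (deg2 θ z') * sgn (deg2 θ z') * sgn_mul_self (deg2 θ z) +
          sgn_mul_self (deg2 θ z')
    simp [h1]
  · obtain ⟨t, ht⟩ := not_forall.mp (mt paired_of_deg2_sum_eq_zero hP)
    simp only [← sgn_add, mul_zero]
    refine sum_sgn_eq_zero
      (fun θ : Param n => deg2 θ z + deg2 θ z' + deg2 θ y + deg2 θ w) (fun s t => ?_) t ht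
    simp only [deg2_add]
    ring

lemma ite_paired {α : Type*} [DecidableEq α] (z z' y w : α) :
    (if Paired z z' y w then (1 : ℂ) else 0) =
      (if z = z' then if y = w then 1 else 0 else 0) +
      (if z = y then if z' = w then 1 else 0 else 0) +
      (if z = w then if z' = y then 1 else 0 else 0) -
      2 * (if z = z' then if z = y then if z = w then 1 else 0 else 0 else 0) := by
  by_cases h1 : z = z'
  · subst h1
    by_cases h2 : z = y
    · subst h2
      by_cases h3 : z = w
      · subst h3
        norm_num [Paired]
      · simp [Paired, h3]
    · by_cases h3 : z = w
      · subst h3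
        simp [Paired, h2, Ne.symm h2]
      · simp [Paired, h2, h3]
  · by_cases h2 : z = y
    · subst h2
      simp [Paired, h1, Ne.symm h1]
    · simp [Paired, h1, h2, ite_and]

/-- Contraction of the paired indicator against `g ⊗ g ⊗ σ`, for a sign vector `g`. -/
lemma sum_paired {α : Type*} [Fintype α] [DecidableEq α] (g : α → ℂ)
    (hg : ∀ z, g z * g z = 1) (σ : Matrix α α ℂ) :
    ∑ z, ∑ z', ∑ y, ∑ w, g z * g z' * σ y w * (if Paired z z' y w then 1 else 0) =
      (Fintype.card α - 2) * σ.trace + (∑ y, ∑ w, g y * g w * σ y w) +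
        ∑ y, ∑ w, g y * g w * σ y w := by
  simp only [ite_paired, mul_sub, mul_add, Finset.sum_sub_distrib, Finset.sum_add_distrib]
  have e1 : ∑ z, ∑ z', ∑ y, ∑ w,
      g z * g z' * σ y w * (if z = z' then if y = w then 1 else 0 else 0) =
      Fintype.card α * σ.trace := by
    have h : ∀ z z' y w, g z * g z' * σ y w * (if z = z' then if y = w then 1 else 0 else 0) =
        (if z = z' then g z * g z' else 0) * (if y = w then σ y w else 0) := by
      intro z z' y w
      split_ifs <;> simp
    simp only [h, ← Finset.mul_sum, ← Finset.sum_mul]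
    simp [hg, Matrix.trace]
  have e2 : ∑ z, ∑ z', ∑ y, ∑ w,
      g z * g z' * σ y w * (if z = y then if z' = w then 1 else 0 else 0) =
      ∑ y, ∑ w, g y * g w * σ y w := by
    simp [mul_ite, Finset.sum_ite_irrel]
  have e3 : ∑ z, ∑ z', ∑ y, ∑ w,
      g z * g z' * σ y w * (if z = w then if z' = y then 1 else 0 else 0) =
      ∑ y, ∑ w, g y * g w * σ y w := by
    rw [Finset.sum_comm]
    simp only [mul_ite, mul_one, mul_zero, Finset.sum_ite_eq, Finset.mem_univ, if_true, mul_comm]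
  have e4 : ∑ z, ∑ z', ∑ y, ∑ w, g z * g z' * σ y w *
      (2 * (if z = z' then if z = y then if z = w then 1 else 0 else 0 else 0)) =
      2 * σ.trace := by
    simp [mul_ite, Finset.sum_ite_irrel, hg, Matrix.trace, Finset.mul_sum, mul_comm]
  rw [e1, e2, e3, e4]
  ring

/-! ### Expanding the fidelity and the score -/

/-- The normalisation `2^(-n/2)`. -/
noncomputable def nrm (n : ℕ) : ℂ := (((Real.sqrt 2)⁻¹ : ℝ) ^ n : ℝ)

lemma nrm_mul_self (n : ℕ) : nrm n * nrm n = ((2 : ℂ) ^ n)⁻¹ := by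
  have h : ((Real.sqrt 2)⁻¹ : ℝ) ^ n * (Real.sqrt 2)⁻¹ ^ n = (2 ^ n)⁻¹ := by
    rw [← mul_pow, ← mul_inv, Real.mul_self_sqrt (by norm_num), inv_pow]
  rw [nrm, ← Complex.ofReal_mul, h]
  push_cast
  rfl

lemma conj_nrm (n : ℕ) : (starRingEnd ℂ) (nrm n) = nrm n := Complex.conj_ofReal _

lemma ψ_apply {n : ℕ} (G : QState n → ZMod 2) (θ : Param n) (z : QState n) :
    ψ G θ z = nrm n * sgn (G z) * sgn (deg2 θ z) := by
  rw [ψ, Uf, Matrix.mulVec_diagonal, sgn_add, plusV, ← nrm]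
  ring

lemma ρnoisy_apply {n : ℕ} (σ : Matrix (QState n) (QState n) ℂ) (θ : Param n)
    (y w : QState n) : ρnoisy σ θ y w = sgn (deg2 θ y) * σ y w * sgn (deg2 θ w) := by
  simp [ρnoisy, Uf, Matrix.diagonal_conjTranspose, conj_sgn]

lemma Hmat_apply {n : ℕ} (x y : QState n) : Hmat n x y = nrm n * sgn (∑ i, x i * y i) := rfl

lemma Fid_eq {n : ℕ} (G : QState n → ZMod 2) (σ : Matrix (QState n) (QState n) ℂ)
    (p : ℝ) (θ : Param n) :
    Fid G σ p θ = ((2 : ℂ) ^ n)⁻¹ * (∑ y, ∑ w, sgn (G y) * sgn (G w) * σ y w) / p := by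
  rw [Fid]
  congr 1
  simp only [Matrix.mulVec, dotProduct, Finset.mul_sum, ψ_apply, ρnoisy_apply, map_mul,
    conj_sgn, conj_nrm, ← nrm_mul_self]
  refine Finset.sum_congr rfl fun y _ => Finset.sum_congr rfl fun w _ => ?_
  linear_combination nrm n * nrm n * sgn (G y) * sgn (G w) * σ y w *
    (sgn (deg2 θ w) * sgn (deg2 θ w) * sgn_mul_self (deg2 θ y) + sgn_mul_self (deg2 θ w))

/-- The signs `(-1)^{x·u}` at four paired points multiply to one. -/
lemma sgn_dot_mul_ite_paired {n : ℕ} (x z z' y w : QState n) :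
    sgn (∑ i, x i * z i) * sgn (∑ i, x i * z' i) * sgn (∑ i, x i * y i) *
      sgn (∑ i, x i * w i) * (if Paired z z' y w then 1 else 0) =
      if Paired z z' y w then 1 else 0 := by
  split_ifs with hP
  · have h := fun u : QState n => sgn_mul_self (∑ i, x i * u i)
    rw [mul_one]
    rcases hP with ⟨rfl, rfl⟩ | ⟨rfl, rfl⟩ | ⟨rfl, rfl⟩
    · rw [h, one_mul, h]
    all_goals
      linear_combination
        sgn (∑ i, x i * z' i) * sgn (∑ i, x i * z' i) * h z + h z'
  · rw [mul_zero]

lemma normSq_mul_diag {n : ℕ} (G : QState n → ZMod 2) (σ : Matrix (QState n) (QState n) ℂ)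
    (θ : Param n) (x : QState n) :
    (Complex.normSq (((Hmat n).mulVec (ψ G θ)) x) : ℂ) * ((Hmat n * ρnoisy σ θ * Hmat n) x x) =
      ∑ z, ∑ z', ∑ y, ∑ w, (((2 : ℂ) ^ n)⁻¹ ^ 3 * (sgn (G z) * sgn (G z') * σ y w) *
        (sgn (∑ i, x i * z i) * sgn (∑ i, x i * z' i) * sgn (∑ i, x i * y i) *
          sgn (∑ i, x i * w i))) *
        (sgn (deg2 θ z) * sgn (deg2 θ z') * sgn (deg2 θ y) * sgn (deg2 θ w)) := by
  have hu : ((Hmat n).mulVec (ψ G θ)) x = nrm n * nrm n *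
      ∑ z, sgn (∑ i, x i * z i) * sgn (G z) * sgn (deg2 θ z) := by
    simp only [Matrix.mulVec, dotProduct, Hmat_apply, ψ_apply, Finset.mul_sum]
    exact Finset.sum_congr rfl fun z _ => by ring
  have hc : (starRingEnd ℂ) (((Hmat n).mulVec (ψ G θ)) x) = ((Hmat n).mulVec (ψ G θ)) x := by
    simp only [hu, map_mul, map_sum, conj_nrm, conj_sgn]
  have hd : (Hmat n * ρnoisy σ θ * Hmat n) x x = nrm n * nrm n *
      ∑ y, ∑ w, sgn (∑ i, x i * y i) * sgn (∑ i, x i * w i) * σ y w *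
        (sgn (deg2 θ y) * sgn (deg2 θ w)) := by
    simp only [Matrix.mul_apply, Hmat_apply, ρnoisy_apply, Finset.mul_sum, Finset.sum_mul]
    rw [Finset.sum_comm]
    refine Finset.sum_congr rfl fun y _ => Finset.sum_congr rfl fun w _ => ?_
    simp only [mul_comm (w _)]
    ring
  rw [← Complex.mul_conj, hc, hu, hd, nrm_mul_self]
  set c := ((2 : ℂ) ^ n)⁻¹
  have hassoc : ∀ A B : ℂ, c * A * (c * A) * (c * B) = c ^ 3 * (A * (A * B)) := fun A B => by ring
  rw [hassoc]
  simp only [Finset.sum_mul]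
  simp only [Finset.mul_sum]
  refine Finset.sum_congr rfl fun z _ => Finset.sum_congr rfl fun z' _ =>
    Finset.sum_congr rfl fun y _ => Finset.sum_congr rfl fun w _ => ?_
  ring

lemma sum_normSq_mul_diag {n : ℕ} (G : QState n → ZMod 2)
    (σ : Matrix (QState n) (QState n) ℂ) (x : QState n) :
    ∑ θ : Param n, (Complex.normSq (((Hmat n).mulVec (ψ G θ)) x) : ℂ) *
        ((Hmat n * ρnoisy σ θ * Hmat n) x x) =
      Fintype.card (Param n) * ((2 : ℂ) ^ n)⁻¹ ^ 3 *
        ((2 ^ n - 2) * σ.trace + 2 * ∑ y, ∑ w, sgn (G y) * sgn (G w) * σ y w) := by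
  have hS := sum_paired (fun z => sgn (G z)) (fun z => sgn_mul_self (G z)) σ
  have hcard : (Fintype.card (QState n) : ℂ) = 2 ^ n := by simp [ZMod.card]
  rw [hcard, add_assoc, ← two_mul] at hS
  rw [← hS]
  simp only [normSq_mul_diag, Finset.mul_sum]
  rw [Finset.sum_comm]
  refine Finset.sum_congr rfl fun z _ => ?_
  rw [Finset.sum_comm]
  refine Finset.sum_congr rfl fun z' _ => ?_
  rw [Finset.sum_comm]
  refine Finset.sum_congr rfl fun y _ => ?_
  rw [Finset.sum_comm]
  refine Finset.sum_congr rfl fun w _ => ?_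
  rw [← Finset.mul_sum, sum_sgn_deg2_four]
  linear_combination Fintype.card (Param n) * ((2 : ℂ) ^ n)⁻¹ ^ 3 *
    (sgn (G z) * sgn (G z') * σ y w) * sgn_dot_mul_ite_paired x z z' y w

/-- (XEB equals twice fidelity for a random final IQP layer.)
For any `G : 𝔽₂ⁿ → 𝔽₂` and any positive semidefinite `σ` with `tr σ = p > 0`,
`E_f[χ(f)] = 2·E_f[F(f)] − 2^{1−n}` for a uniformly random degree-2 polynomial `f`. -/
theorem xeb_eq_two_fid {n : ℕ} (hn : 1 ≤ n) (G : QState n → ZMod 2)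
    (σ : Matrix (QState n) (QState n) ℂ) (hσ : σ.PosSemidef)
    (p : ℝ) (hp : σ.trace = (p : ℂ)) (hppos : 0 < p) :
    ((Fintype.card (Param n) : ℂ))⁻¹ * (∑ θ : Param n, Xeb G σ p θ) =
      2 * (((Fintype.card (Param n) : ℂ))⁻¹ * ∑ θ : Param n, Fid G σ p θ) -
        2 * ((2 : ℂ) ^ n)⁻¹ := by
  have hp0 : (p : ℂ) ≠ 0 := Complex.ofReal_ne_zero.mpr hppos.ne'
  have hN : (2 : ℂ) ^ n ≠ 0 := pow_ne_zero _ two_ne_zero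
  have hcard : (Fintype.card (Param n) : ℂ) ≠ 0 := Nat.cast_ne_zero.mpr Fintype.card_ne_zero
  have hQ : (Fintype.card (QState n) : ℂ) = 2 ^ n := by simp [ZMod.card]
  simp only [Xeb, Fid_eq, Finset.sum_sub_distrib, ← Finset.mul_sum]
  rw [Finset.sum_comm]
  simp only [sum_normSq_mul_diag, Finset.sum_const, Finset.card_univ, nsmul_eq_mul, hp, hQ]
  field_simp
  ring

end Stmt10
end

section
/- (Adversarial bit-flip noise breaks the XEB–fidelity correspondence.) Let n ≥ 1, 0 ≤ p ≤ 1/2, let f be a uniformly random degree-2 polynomial, |ψ_f⟩ = U_f|+ⁿ⟩, and ρ_f = (1−p)|ψ_f⟩⟨ψ_f| + p · X₁|ψ_f⟩⟨ψ_f|X₁, where X₁ is Pauli-X on the first qubit. Then: (a) for every f and every x ∈ 𝔽₂ⁿ, ⟨x|H^{⊗n} ρ_f H^{⊗n}|x⟩ = |⟨x|H^{⊗n}|ψ_f⟩|², i.e., the noisy X-basis output distribution coincides exactly with the ideal one (so the XEB score takes its noiseless value for every f); and (b) the average fidelity satisfies E_f[ ⟨ψ_f| ρ_f |ψ_f⟩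 ] = (1−p) + p·2^(1−n). -/
open scoped BigOperators
open Matrix

namespace Stmt11

/-- Computational basis labels for `n` qubits: `𝔽₂ⁿ`. -/
abbrev QState (n : ℕ) := Fin n → ZMod 2

/-- Index pairs `i < j` of qubits. -/
abbrev PairIdx (n : ℕ) := {p : Fin n × Fin n // p.1 < p.2}

/-- `(-1)^a` as a complex number. -/
def sgn (a : ZMod 2) : ℂ := (-1 : ℂ) ^ a.val

/-- Parameters of a uniformly random degree-2 polynomial. -/
abbrev Param (n : ℕ) := QState n × (PairIdx n → ZMod 2)

/-- The degree-2 polynomial `f(z) = Σ_{i<j} b_{ij} z_i z_j + Σ_i a_i z_i` over `𝔽₂`. -/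
def deg2 {n : ℕ} (θ : Param n) (z : QState n) : ZMod 2 :=
  (∑ p : PairIdx n, θ.2 p * z p.1.1 * z p.1.2) + ∑ i, θ.1 i * z i

/-- The diagonal unitary `U_f|x⟩ = (−1)^{f(x)}|x⟩`. -/
noncomputable def Uf {n : ℕ} (f : QState n → ZMod 2) : Matrix (QState n) (QState n) ℂ :=
  Matrix.diagonal fun x => sgn (f x)

/-- The uniform superposition `|+ⁿ⟩`. -/
noncomputable def plusV (n : ℕ) : QState n → ℂ := fun _ => (((Real.sqrt 2)⁻¹ : ℝ) ^ n : ℝ)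

/-- The `n`-fold Hadamard. -/
noncomputable def Hmat (n : ℕ) : Matrix (QState n) (QState n) ℂ :=
  Matrix.of fun x y => (((Real.sqrt 2)⁻¹ : ℝ) ^ n : ℝ) * sgn (∑ i, x i * y i)

/-- The ideal state `|ψ_f⟩ = U_f|+ⁿ⟩`. -/
noncomputable def ψ {n : ℕ} (θ : Param n) : QState n → ℂ :=
  (Uf (deg2 θ)).mulVec (plusV n)

/-- The bit string `e₁` (indicator of the first qubit). -/
def e1 (n : ℕ) (hn : 1 ≤ n) : QState n := fun j => if j = ⟨0, hn⟩ then 1 else 0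

/-- `X₁|ψ⟩`: Pauli-X on the first qubit, acting as `|x⟩ ↦ |x ⊕ e₁⟩`. -/
noncomputable def X1vec {n : ℕ} (hn : 1 ≤ n) (v : QState n → ℂ) : QState n → ℂ :=
  fun x => v (x + e1 n hn)

/-- The noisy state `ρ_f = (1−p)|ψ_f⟩⟨ψ_f| + p X₁|ψ_f⟩⟨ψ_f|X₁`. -/
noncomputable def ρnoisy {n : ℕ} (hn : 1 ≤ n) (p : ℝ) (θ : Param n) :
    Matrix (QState n) (QState n) ℂ :=
  ((1 - p : ℝ) : ℂ) • Matrix.vecMulVec (ψ θ) (star (ψ θ)) +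
    ((p : ℝ) : ℂ) • Matrix.vecMulVec (X1vec hn (ψ θ)) (star (X1vec hn (ψ θ)))

lemma sgn_add (a b : ZMod 2) : sgn (a + b) = sgn a * sgn b := by
  have h : (a + b).val % 2 = (a.val + b.val) % 2 := by revert a b; decide
  rw [sgn, sgn, sgn, ← pow_add, neg_one_pow_eq_pow_mod_two, h, ← neg_one_pow_eq_pow_mod_two]

lemma sgn_zero : sgn 0 = 1 := by simp [sgn]

lemma sgn_one : sgn 1 = -1 := by simp [sgn, ZMod.val_one]

lemma sgn_mul_self (a : ZMod 2) : sgn a * sgn a = 1 := by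
  rw [← sgn_add, CharTwo.add_self_eq_zero, sgn_zero]

lemma star_sgn (a : ZMod 2) : (starRingEnd ℂ) (sgn a) = sgn a := by
  simp [sgn]

/-- The normalisation `2^(-n/2)` satisfies `c² = 2^(-n)`. -/
lemma amplitude_mul_self (n : ℕ) :
    ((((Real.sqrt 2)⁻¹ : ℝ) ^ n : ℝ) : ℂ) * ((((Real.sqrt 2)⁻¹ : ℝ) ^ n : ℝ) : ℂ) =
      ((2 : ℂ) ^ n)⁻¹ := by
  have h : ((Real.sqrt 2)⁻¹ : ℝ) ^ n * ((Real.sqrt 2)⁻¹ : ℝ) ^ n = ((2 : ℝ) ^ n)⁻¹ := by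
    rw [← mul_pow, ← mul_inv, Real.mul_self_sqrt (by norm_num), inv_pow]
  rw [← Complex.ofReal_mul, h]
  push_cast
  rfl

lemma ψ_apply {n : ℕ} (θ : Param n) (x : QState n) :
    ψ θ x = sgn (deg2 θ x) * (((Real.sqrt 2)⁻¹ : ℝ) ^ n : ℝ) := by
  simp [ψ, Uf, plusV, Matrix.mulVec_diagonal]

lemma star_ψ {n : ℕ} (θ : Param n) (x : QState n) :
    (starRingEnd ℂ) (ψ θ x) = ψ θ x := by
  rw [ψ_apply, map_mul, star_sgn, Complex.conj_ofReal]

lemma e1_add_e1 {n : ℕ} (hn : 1 ≤ n) : e1 n hn + e1 n hn = 0 :=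
  funext fun i => CharTwo.add_self_eq_zero (e1 n hn i)

lemma add_e1_add_e1 {n : ℕ} (hn : 1 ≤ n) (x : QState n) : x + e1 n hn + e1 n hn = x := by
  rw [add_assoc, e1_add_e1, add_zero]

lemma e1_ne_zero {n : ℕ} (hn : 1 ≤ n) : e1 n hn ≠ 0 := fun h => by
  simpa [e1] using congrFun h ⟨0, hn⟩

lemma Hmat_add_e1 {n : ℕ} (hn : 1 ≤ n) (x y : QState n) :
    Hmat n x (y + e1 n hn) = sgn (x ⟨0, hn⟩) * Hmat n x y := by
  have h : ∑ i, x i * (y + e1 n hn) i = x ⟨0, hn⟩ + ∑ i, x i * y i := by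
    simp [mul_add, Finset.sum_add_distrib, e1, add_comm]
  simp only [Hmat, Matrix.of_apply, h, sgn_add]
  ring

/-- In the Hadamard basis, `X₁` acts by a sign. -/
lemma Hmat_mulVec_X1vec {n : ℕ} (hn : 1 ≤ n) (v : QState n → ℂ) (x : QState n) :
    (Hmat n).mulVec (X1vec hn v) x = sgn (x ⟨0, hn⟩) * (Hmat n).mulVec v x := by
  simp only [Matrix.mulVec, dotProduct, X1vec, Finset.mul_sum]
  rw [← Equiv.sum_comp (Equiv.addRight (e1 n hn))]
  refine Finset.sum_congr rfl fun y _ => ?_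
  simp only [Equiv.coe_addRight, add_e1_add_e1, Hmat_add_e1]
  ring

lemma Hmat_conjTranspose (n : ℕ) : (Hmat n)ᴴ = Hmat n := by
  ext x y
  simp only [Matrix.conjTranspose_apply, Hmat, Matrix.of_apply, ← starRingEnd_apply, map_mul,
    star_sgn, Complex.conj_ofReal, mul_comm (y _)]

lemma Hmat_vecMulVec_Hmat_apply_self {n : ℕ} (v : QState n → ℂ) (x : QState n) :
    (Hmat n * Matrix.vecMulVec v (star v) * Hmat n) x x =
      (Complex.normSq ((Hmat n).mulVec v x) : ℂ) := by
  have h : Matrix.vecMul (star v) (Hmat n) = star ((Hmat n).mulVec v) := by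
    rw [Matrix.star_mulVec, Hmat_conjTranspose]
  rw [Matrix.mul_vecMulVec, Matrix.vecMulVec_mul, h, Matrix.vecMulVec_apply, Pi.star_apply,
    ← starRingEnd_apply, Complex.mul_conj]

lemma normSq_sgn (a : ZMod 2) : Complex.normSq (sgn a) = 1 := by
  simp [sgn]

lemma noisy_output_eq_ideal {n : ℕ} (hn : 1 ≤ n) (p : ℝ) (θ : Param n) (x : QState n) :
    (Hmat n * ρnoisy hn p θ * Hmat n) x x =
      (Complex.normSq ((Hmat n).mulVec (ψ θ) x) : ℂ) := by
  rw [ρnoisy, Matrix.mul_add, Matrix.add_mul, Matrix.mul_smul, Matrix.mul_smul, Matrix.smul_mul,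
    Matrix.smul_mul, Matrix.add_apply, Matrix.smul_apply, Matrix.smul_apply,
    Hmat_vecMulVec_Hmat_apply_self, Hmat_vecMulVec_Hmat_apply_self, Hmat_mulVec_X1vec,
    Complex.normSq_mul, normSq_sgn]
  simp only [smul_eq_mul]
  push_cast
  ring

lemma sum_conj_mul_vecMulVec_mulVec {ι : Type*} [Fintype ι] (u v : ι → ℂ) :
    ∑ x, (starRingEnd ℂ) (u x) * (Matrix.vecMulVec v (star v)).mulVec u x =
      (∑ x, (starRingEnd ℂ) (u x) * v x) * ∑ x, (starRingEnd ℂ) (v x) * u x := by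
  rw [Finset.sum_mul]
  refine Finset.sum_congr rfl fun x _ => ?_
  simp only [Matrix.vecMulVec_mulVec, Pi.smul_apply, dotProduct, Pi.star_apply,
    starRingEnd_apply, MulOpposite.smul_eq_mul_unop, MulOpposite.unop_op]
  ring

/-- The derivative of the degree-2 polynomial in the direction `e₁`. -/
def derivE1 {n : ℕ} (hn : 1 ≤ n) (θ : Param n) (x : QState n) : ZMod 2 :=
  deg2 θ x + deg2 θ (x + e1 n hn)

lemma sum_ψ_mul_self {n : ℕ} (θ : Param n) : ∑ x, ψ θ x * ψ θ x = 1 := by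
  have h (x : QState n) : ψ θ x * ψ θ x = ((2 : ℂ) ^ n)⁻¹ := by
    rw [ψ_apply, mul_mul_mul_comm, sgn_mul_self, amplitude_mul_self, one_mul]
  simp [h, ZMod.card]

lemma sum_ψ_mul_X1vec {n : ℕ} (hn : 1 ≤ n) (θ : Param n) :
    ∑ x, ψ θ x * X1vec hn (ψ θ) x = ((2 : ℂ) ^ n)⁻¹ * ∑ x, sgn (derivE1 hn θ x) := by
  rw [Finset.mul_sum]
  refine Finset.sum_congr rfl fun x _ => ?_
  rw [X1vec, ψ_apply, ψ_apply, mul_mul_mul_comm, amplitude_mul_self, derivE1, sgn_add, mul_comm]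

lemma fidelity_eq {n : ℕ} (hn : 1 ≤ n) (p : ℝ) (θ : Param n) :
    ∑ x, (starRingEnd ℂ) (ψ θ x) * ((ρnoisy hn p θ).mulVec (ψ θ)) x =
      ((1 - p : ℝ) : ℂ) + (p : ℂ) * (((2 : ℂ) ^ n)⁻¹ * ((2 : ℂ) ^ n)⁻¹ *
        ∑ x, ∑ y, sgn (derivE1 hn θ x + derivE1 hn θ y)) := by
  have hX (x : QState n) : (starRingEnd ℂ) (X1vec hn (ψ θ) x) = X1vec hn (ψ θ) x := star_ψ θ _
  have h0 := sum_conj_mul_vecMulVec_mulVec (ψ θ) (ψ θ)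
  have h1 := sum_conj_mul_vecMulVec_mulVec (ψ θ) (X1vec hn (ψ θ))
  simp only [star_ψ, hX, mul_comm (X1vec hn (ψ θ) _), sum_ψ_mul_self, sum_ψ_mul_X1vec] at h0 h1
  simp only [ρnoisy, Matrix.add_mulVec, Matrix.smul_mulVec, Pi.add_apply, Pi.smul_apply,
    smul_eq_mul, mul_add, Finset.sum_add_distrib, star_ψ, mul_left_comm (ψ θ _) (Complex.ofReal _),
    ← Finset.mul_sum, h0, h1, sgn_add, ← Finset.sum_mul]
  ring

lemma deg2_add {n : ℕ} (θ η : Param n) (z : QState n) :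
    deg2 (θ + η) z = deg2 θ z + deg2 η z := by
  simp only [deg2, Prod.fst_add, Prod.snd_add, Pi.add_apply, add_mul, Finset.sum_add_distrib]
  ring

lemma derivE1_add {n : ℕ} (hn : 1 ≤ n) (θ η : Param n) (z : QState n) :
    derivE1 hn (θ + η) z = derivE1 hn θ z + derivE1 hn η z := by
  simp only [derivE1, deg2_add]
  ring

lemma derivE1_add_e1 {n : ℕ} (hn : 1 ≤ n) (θ : Param n) (x : QState n) :
    derivE1 hn θ (x + e1 n hn) = derivE1 hn θ x := by
  rw [derivE1, derivE1, add_e1_add_e1, add_comm]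

lemma derivE1_single {n : ℕ} (hn : 1 ≤ n) (j : Fin n) (hj : ⟨0, hn⟩ < j) (x : QState n) :
    derivE1 hn (0, Pi.single ⟨(⟨0, hn⟩, j), hj⟩ 1) x = x j := by
  have h (z : QState n) :
      deg2 (0, Pi.single ⟨(⟨0, hn⟩, j), hj⟩ 1) z = z ⟨0, hn⟩ * z j := by
    simp [deg2, Pi.single_apply, ite_mul]
  simp only [derivE1, h, Pi.add_apply, e1, if_neg hj.ne', if_true, add_zero]
  rw [add_mul, one_mul, ← add_assoc, CharTwo.add_self_eq_zero, zero_add]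

lemma exists_ne_of_ne_add_e1 {n : ℕ} (hn : 1 ≤ n) {x y : QState n} (h0 : y ≠ x)
    (h1 : y ≠ x + e1 n hn) : ∃ j, ⟨0, hn⟩ < j ∧ x j ≠ y j := by
  by_contra! h
  have hj (j : Fin n) (hj : j ≠ ⟨0, hn⟩) : x j = y j :=
    h j (Fin.lt_def.2 (Nat.pos_of_ne_zero fun h => hj (Fin.ext h)))
  have key : ∀ a b : ZMod 2, b = a ∨ b = a + 1 := by decide
  rcases key (x ⟨0, hn⟩) (y ⟨0, hn⟩) with h | h
  · refine h0 (funext fun j => ?_)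
    by_cases hj0 : j = ⟨0, hn⟩
    · rw [hj0, h]
    · rw [hj j hj0]
  · refine h1 (funext fun j => ?_)
    by_cases hj0 : j = ⟨0, hn⟩
    · simp [hj0, h, e1]
    · simp [hj j hj0, e1, hj0]

lemma sum_sgn_derivE1 {n : ℕ} (hn : 1 ≤ n) (x y : QState n) :
    ∑ θ : Param n, sgn (derivE1 hn θ x + derivE1 hn θ y) =
      if y ∈ ({x, x + e1 n hn} : Finset (QState n)) then (Fintype.card (Param n) : ℂ) else 0 := by
  split_ifs with h
  · have hD (θ : Param n) : derivE1 hn θ y = derivE1 hn θ x := by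
      rcases Finset.mem_insert.1 h with h | h
      · rw [h]
      · rw [Finset.mem_singleton.1 h, derivE1_add_e1]
    simp only [hD, CharTwo.add_self_eq_zero, sgn_zero, Finset.sum_const, nsmul_eq_mul, mul_one,
      Finset.card_univ]
  · simp only [Finset.mem_insert, Finset.mem_singleton, not_or] at h
    obtain ⟨j, hj, hxy⟩ := exists_ne_of_ne_add_e1 hn h.1 h.2
    have key : ∀ a b : ZMod 2, a ≠ b → a + b = 1 := by decide
    rw [← self_eq_neg, ← Finset.sum_neg_distrib,
      ← Equiv.sum_comp (Equiv.addRight ((0, Pi.single ⟨(⟨0, hn⟩, j), hj⟩ 1) : Param n))]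
    refine Finset.sum_congr rfl fun θ _ => ?_
    rw [Equiv.coe_addRight, derivE1_add, derivE1_add, derivE1_single, derivE1_single,
      add_add_add_comm, key _ _ hxy, sgn_add, sgn_one, mul_neg_one]

lemma sum_sum_sum_sgn_derivE1 {n : ℕ} (hn : 1 ≤ n) :
    ∑ θ : Param n, ∑ x, ∑ y, sgn (derivE1 hn θ x + derivE1 hn θ y) =
      (Fintype.card (Param n) : ℂ) * (2 * 2 ^ n) := by
  have hx (x : QState n) : ({x, x + e1 n hn} : Finset (QState n)).card = 2 :=
    Finset.card_pair fun h => e1_ne_zero hn (left_eq_add.1 h)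
  rw [Finset.sum_comm]
  simp only [Finset.sum_comm (s := (Finset.univ : Finset (Param n))), sum_sgn_derivE1,
    Finset.sum_ite_mem, Finset.univ_inter, Finset.sum_const, hx, Finset.card_univ, nsmul_eq_mul,
    Fintype.card_fun, ZMod.card, Fintype.card_fin]
  push_cast
  ring

/-- (Adversarial bit-flip noise breaks the XEB–fidelity
correspondence.)  (a) For every `f` and every `x`, the noisy X-basis output probability
`⟨x|H^{⊗n} ρ_f H^{⊗n}|x⟩` coincides with the ideal one `|⟨x|H^{⊗n}|ψ_f⟩|²` (so the XEB
score takes its noiseless value for every `f`); and (b) the average fidelity satisfies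
`E_f[⟨ψ_f|ρ_f|ψ_f⟩] = (1−p) + p·2^{1−n}`. -/
theorem adversarial_noise {n : ℕ} (hn : 1 ≤ n) (p : ℝ) (hp0 : 0 ≤ p) (hp : p ≤ 1 / 2) :
    (∀ θ : Param n, ∀ x : QState n,
      (Hmat n * ρnoisy hn p θ * Hmat n) x x =
        (Complex.normSq (((Hmat n).mulVec (ψ θ)) x) : ℂ)) ∧
    ((Fintype.card (Param n) : ℂ))⁻¹ *
        (∑ θ : Param n, ∑ x : QState n,
          (starRingEnd ℂ) (ψ θ x) * ((ρnoisy hn p θ).mulVec (ψ θ)) x) =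
      ((1 - p : ℝ) : ℂ) + (p : ℂ) * (2 * ((2 : ℂ) ^ n)⁻¹) := by
  refine ⟨noisy_output_eq_ideal hn p, ?_⟩
  have hN : (Fintype.card (Param n) : ℂ) ≠ 0 := Nat.cast_ne_zero.2 Fintype.card_ne_zero
  simp only [fidelity_eq, Finset.sum_add_distrib, ← Finset.mul_sum, sum_sum_sum_sgn_derivE1,
    Finset.sum_const, Finset.card_univ, nsmul_eq_mul]
  generalize (Fintype.card (Param n) : ℂ) = N at hN ⊢
  field_simp

end Stmt11
end

section
/- (Structure of the z-twirl of a completely positive map.) Let n ≥ 1 and let (K_μ)_{μ∈M} be any finite family of 2ⁿ×2ⁿ complex matrices. For b ∈ 𝔽₂ⁿ and μ ∈ M define the diagonal matrix D_{μ,b} = 2^(−n) Σ_{a∈𝔽₂ⁿ} tr( K_μ Z^a X^b ) · Z^a. Then for every 2ⁿ×2ⁿ matrix ρ: 2^(−n) Σ_{a∈𝔽₂ⁿ} Σ_{μ∈M} (Z^a K_μ Z^a) ρ (Z^a K_μ Z^a)† = Σ_{μ∈M} Σ_{b∈𝔽₂ⁿ} (X^b D_{μ,b}) ρ (X^b D_{μ,b})†.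 In particular, the z-twirl of any completely positive map has a Kraus representation in which every Kraus operator is a Pauli-X string times a diagonal matrix. -/
open scoped BigOperators
open Matrix

namespace Stmt12

/-- Computational basis labels for `n` qubits: `𝔽₂ⁿ`. -/
abbrev QState (n : ℕ) := Fin n → ZMod 2

/-- `(-1)^a` as a complex number. -/
def sgn (a : ZMod 2) : ℂ := (-1 : ℂ) ^ a.val

/-- The Pauli-Z string `Z^a|x⟩ = (−1)^{a·x}|x⟩`. -/
noncomputable def Zmat {n : ℕ} (a : QState n) : Matrix (QState n) (QState n) ℂ :=
  Matrix.diagonal fun x => sgn (∑ i, a i * x i)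

/-- The Pauli-X string `X^b|x⟩ = |x ⊕ b⟩`. -/
noncomputable def Xmat {n : ℕ} (b : QState n) : Matrix (QState n) (QState n) ℂ :=
  Matrix.of fun x y => if x = y + b then 1 else 0

/-- The diagonal matrix `D_{μ,b} = 2^{−n} Σ_a tr(K_μ Z^a X^b) · Z^a`. -/
noncomputable def Dmat {n : ℕ} {M : Type*} [Fintype M] (K : M → Matrix (QState n) (QState n) ℂ)
    (μ : M) (b : QState n) : Matrix (QState n) (QState n) ℂ :=
  ((2 : ℂ) ^ n)⁻¹ • ∑ a : QState n, (Matrix.trace (K μ * Zmat a * Xmat b)) • Zmat a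

theorem sgn_zero : sgn 0 = 1 := by simp [sgn]

theorem sgn_one : sgn 1 = -1 := by simp [sgn, ZMod.val_one]

theorem eq_zero_or_eq_one_zmod_two : ∀ t : ZMod 2, t = 0 ∨ t = 1 := by decide

theorem sgn_add (s t : ZMod 2) : sgn (s + t) = sgn s * sgn t := by
  rcases eq_zero_or_eq_one_zmod_two s with rfl | rfl <;>
    rcases eq_zero_or_eq_one_zmod_two t with rfl | rfl <;>
    simp [sgn_zero, sgn_one, show (1 + 1 : ZMod 2) = 0 from rfl]

theorem star_sgn (s : ZMod 2) : star (sgn s) = sgn s := by simp [sgn]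

theorem sgn_sum {ι : Type*} (s : Finset ι) (f : ι → ZMod 2) :
    sgn (∑ i ∈ s, f i) = ∏ i ∈ s, sgn (f i) := by
  classical
  induction s using Finset.induction_on with
  | empty => simp [sgn_zero]
  | insert i s hi ih => rw [Finset.sum_insert hi, Finset.prod_insert hi, sgn_add, ih]

theorem sum_sgn_mul (t : ZMod 2) : ∑ s : ZMod 2, sgn (s * t) = if t = 0 then 2 else 0 := by
  have h : ∀ f : ZMod 2 → ℂ, ∑ s, f s = f 0 + f 1 := fun f => Fin.sum_univ_two f
  rw [h]
  rcases eq_zero_or_eq_one_zmod_two t with rfl | rfl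
  · simp only [mul_zero, sgn_zero, if_true]
    norm_num
  · simp [sgn_zero, sgn_one]

/-- Orthogonality of the characters of `𝔽₂ⁿ`. -/
theorem sum_sgn_dot {n : ℕ} (x : QState n) :
    ∑ a : QState n, sgn (∑ i, a i * x i) = if x = 0 then (2 : ℂ) ^ n else 0 := by
  simp only [sgn_sum]
  have h := Finset.prod_univ_sum (fun _ : Fin n => (Finset.univ : Finset (ZMod 2)))
    (fun i s => sgn (s * x i))
  rw [Fintype.piFinset_univ] at h
  rw [← h]
  simp only [sum_sgn_mul]
  split_ifs with hx
  · simp [hx]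
  · obtain ⟨i, hi⟩ := Function.ne_iff.mp hx
    exact Finset.prod_eq_zero (Finset.mem_univ i) (if_neg hi)

theorem sgn_dot_add {n : ℕ} (a x y : QState n) :
    sgn (∑ i, a i * (x + y) i) = sgn (∑ i, a i * x i) * sgn (∑ i, a i * y i) := by
  rw [← sgn_add, ← Finset.sum_add_distrib]
  simp only [Pi.add_apply, mul_add]

theorem add_eq_zero_iff_eq_of_qstate {n : ℕ} (x y : QState n) : x + y = 0 ↔ x = y := by
  rw [add_eq_zero_iff_eq_neg, show -y = y from funext fun i => ZMod.neg_eq_self_mod_two (y i)]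

theorem Zmat_mul_mul_Zmat_apply {n : ℕ} (a : QState n) (A : Matrix (QState n) (QState n) ℂ)
    (x y : QState n) :
    (Zmat a * A * Zmat a) x y = sgn (∑ i, a i * (x + y) i) * A x y := by
  rw [sgn_dot_add, Zmat, Matrix.mul_diagonal, Matrix.diagonal_mul]
  ring

theorem trace_mul_Zmat_mul_Xmat {n : ℕ} (A : Matrix (QState n) (QState n) ℂ) (a b : QState n) :
    Matrix.trace (A * Zmat a * Xmat b) =
      ∑ x, A x (x + b) * sgn (∑ i, a i * (x + b) i) := by
  simp only [Matrix.trace, Matrix.diag_apply, Matrix.mul_apply (M := A * Zmat a)]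
  refine Finset.sum_congr rfl fun x _ => ?_
  simp [Zmat, Xmat, Matrix.mul_diagonal]

theorem Dmat_eq_diagonal {n : ℕ} {M : Type*} [Fintype M]
    (K : M → Matrix (QState n) (QState n) ℂ) (μ : M) (b : QState n) :
    Dmat K μ b = Matrix.diagonal fun y => K μ (y + b) y := by
  have hbb : b + b = 0 := (add_eq_zero_iff_eq_of_qstate b b).2 rfl
  ext x y
  simp only [Dmat, Matrix.smul_apply, Matrix.sum_apply, Zmat, Matrix.diagonal_apply]
  split_ifs with hxy
  · subst hxy
    have h : ∑ a : QState n, Matrix.trace (K μ * Zmat a * Xmat b) * sgn (∑ i, a i * x i) =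
        2 ^ n * K μ (x + b) x := by
      simp only [trace_mul_Zmat_mul_Xmat, Finset.sum_mul]
      simp only [mul_assoc (K μ _ _), ← sgn_dot_add]
      rw [Finset.sum_comm]
      simp only [← Finset.mul_sum, sum_sgn_dot]
      rw [Finset.sum_eq_single (x + b)]
      · rw [add_assoc x b b, hbb, add_zero, if_pos ((add_eq_zero_iff_eq_of_qstate x x).2 rfl),
          mul_comm]
      · intro z _ hz
        rw [if_neg, mul_zero]
        rw [add_eq_zero_iff_eq_of_qstate]
        rintro rfl
        exact hz (by rw [add_assoc, hbb, add_zero])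
      · simp
    simp only [Zmat] at h
    simp only [smul_eq_mul]
    rw [h, inv_mul_cancel_left₀ (pow_ne_zero n two_ne_zero)]
  · simp

theorem Xmat_mul_Dmat_apply {n : ℕ} {M : Type*} [Fintype M]
    (K : M → Matrix (QState n) (QState n) ℂ) (μ : M) (b x y : QState n) :
    (Xmat b * Dmat K μ b) x y = if b = x + y then K μ x y else 0 := by
  have h : x = y + b ↔ b = x + y := by
    rw [← add_eq_zero_iff_eq_of_qstate, ← add_eq_zero_iff_eq_of_qstate b,
      show x + (y + b) = b + (x + y) by abel]
  rw [Dmat_eq_diagonal, Matrix.mul_diagonal]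
  by_cases hb : b = x + y
  · rw [if_pos hb, Xmat, Matrix.of_apply, if_pos (h.2 hb), one_mul, ← h.2 hb]
  · rw [if_neg hb, Xmat, Matrix.of_apply, if_neg (mt h.1 hb), zero_mul]

theorem mul_mul_conjTranspose_apply {ι : Type*} [Fintype ι] (A ρ : Matrix ι ι ℂ) (x y : ι) :
    (A * ρ * Aᴴ) x y = ∑ k, ∑ j, A x j * ρ j k * star (A y k) := by
  simp only [Matrix.mul_apply, Matrix.conjTranspose_apply, Finset.sum_mul]

theorem ztwirl_single {n : ℕ} {M : Type*} [Fintype M]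
    (K : M → Matrix (QState n) (QState n) ℂ) (μ : M) (ρ : Matrix (QState n) (QState n) ℂ) :
    ((2 : ℂ) ^ n)⁻¹ • ∑ a : QState n, (Zmat a * K μ * Zmat a) * ρ * (Zmat a * K μ * Zmat a)ᴴ =
      ∑ b : QState n, (Xmat b * Dmat K μ b) * ρ * (Xmat b * Dmat K μ b)ᴴ := by
  ext x y
  simp only [Matrix.smul_apply, Matrix.sum_apply, mul_mul_conjTranspose_apply,
    Zmat_mul_mul_Zmat_apply, Xmat_mul_Dmat_apply, smul_eq_mul]
  rw [Finset.sum_comm, Finset.sum_comm (s := (Finset.univ : Finset (QState n)))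
    (t := (Finset.univ : Finset (QState n)))
    (f := fun b k => ∑ j, (if b = x + j then K μ x j else 0) * ρ j k *
      star (if b = y + k then K μ y k else 0)), Finset.mul_sum]
  refine Finset.sum_congr rfl fun k _ => ?_
  rw [Finset.sum_comm, Finset.sum_comm (s := (Finset.univ : Finset (QState n)))
    (t := (Finset.univ : Finset (QState n)))
    (f := fun b j => (if b = x + j then K μ x j else 0) * ρ j k *
      star (if b = y + k then K μ y k else 0)), Finset.mul_sum]
  refine Finset.sum_congr rfl fun j _ => ?_
  have hl : ∀ a : QState n, sgn (∑ i, a i * (x + j) i) * K μ x j * ρ j k *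
      star (sgn (∑ i, a i * (y + k) i) * K μ y k) =
      sgn (∑ i, a i * ((x + j) + (y + k)) i) * (K μ x j * ρ j k * star (K μ y k)) := by
    intro a
    rw [sgn_dot_add a (x + j), star_mul', star_sgn]
    ring
  simp only [hl, ← Finset.sum_mul, sum_sgn_dot, add_eq_zero_iff_eq_of_qstate]
  rw [Finset.sum_eq_single (x + j) (fun b _ hb => by rw [if_neg hb, zero_mul, zero_mul])
    (by simp)]
  rw [if_pos rfl]
  split_ifs
  · rw [inv_mul_cancel_left₀ (pow_ne_zero n two_ne_zero)]
  · simp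

/-- (Structure of the z-twirl of a completely positive map.)
For any finite family of Kraus operators `(K_μ)` and any matrix `ρ`,
`2^{−n} Σ_a Σ_μ (Z^a K_μ Z^a) ρ (Z^a K_μ Z^a)† = Σ_μ Σ_b (X^b D_{μ,b}) ρ (X^b D_{μ,b})†`;
in particular, the z-twirl of any completely positive map has a Kraus representation in
which every Kraus operator is a Pauli-X string times a diagonal matrix. -/
theorem ztwirl_structure {n : ℕ} (hn : 1 ≤ n) {M : Type*} [Fintype M]
    (K : M → Matrix (QState n) (QState n) ℂ) (ρ : Matrix (QState n) (QState n) ℂ) :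
    ((2 : ℂ) ^ n)⁻¹ •
        ∑ a : QState n, ∑ μ : M, (Zmat a * K μ * Zmat a) * ρ * (Zmat a * K μ * Zmat a)ᴴ =
      ∑ μ : M, ∑ b : QState n, (Xmat b * Dmat K μ b) * ρ * (Xmat b * Dmat K μ b)ᴴ := by
  rw [Finset.sum_comm, Finset.smul_sum]
  exact Finset.sum_congr rfl fun μ _ => ztwirl_single K μ ρ

end Stmt12
end

section
/- (Hiding for degree-D Bell sampling.) Let n ≥ 1, D ≥ 2, and 0 ≤ k ≤ n−1. Let (x,z) and (x′,z′) be pairs in 𝔽₂ⁿ × 𝔽₂ⁿ with |supp(x)| = |supp(x′)| = n−k, supp(z) ∩ supp(x) = ∅, and supp(z′) ∩ supp(x′) = ∅. Then there exists a bijection τ : Ω_D(n) → Ω_D(n) such that P_{τ(f)}(x′, z′) = P_f(x, z) for every f ∈ Ω_D(n). Consequently, for uniformly random f ∈ Ω_D(n), the random variable P_f(x,z) has the same distribution for every outcome (x,z) in the sector with |supp(x)| = n−k and supp(z) ∩ supp(x) = ∅. -/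
open scoped BigOperators
open Matrix

namespace Stmt17

/-- Computational basis labels for `n` qubits: `𝔽₂ⁿ`. -/
abbrev QState (n : ℕ) := Fin n → ZMod 2

/-- `(-1)^a` as a complex number. -/
def sgn (a : ZMod 2) : ℂ := (-1 : ℂ) ^ a.val

/-- `f : 𝔽₂ⁿ → 𝔽₂` has degree `≤ D`: in its multilinear expansion
`f(z) = Σ_T c_T Π_{i∈T} z_i` all coefficients `c_T` with `|T| > D` vanish. -/
def DegLE (n D : ℕ) (f : QState n → ZMod 2) : Prop :=
  ∃ c : Finset (Fin n) → ZMod 2,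
    (∀ T : Finset (Fin n), D < T.card → c T = 0) ∧
    ∀ z : QState n, f z = ∑ T : Finset (Fin n), c T * ∏ i ∈ T, z i

/-- `Ω_D(n)`: the set of functions `𝔽₂ⁿ → 𝔽₂` of degree at most `D`. -/
abbrev Omega (n D : ℕ) := {f : QState n → ZMod 2 // DegLE n D f}

/-- The support `{i : vᵢ = 1}` of a bit string. -/
def suppF {n : ℕ} (v : QState n) : Finset (Fin n) :=
  Finset.univ.filter fun i => v i = 1

/-- The diagonal unitary `U_f|x⟩ = (−1)^{f(x)}|x⟩`. -/
noncomputable def Uf {n : ℕ} (f : QState n → ZMod 2) : Matrix (QState n) (QState n) ℂ :=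
  Matrix.diagonal fun x => sgn (f x)

/-- The uniform superposition `|+ⁿ⟩`. -/
noncomputable def plusV (n : ℕ) : QState n → ℂ := fun _ => (((Real.sqrt 2)⁻¹ : ℝ) ^ n : ℝ)

/-- The phase state `|ψ_f⟩ = U_f|+ⁿ⟩`. -/
noncomputable def ψ {n : ℕ} (f : QState n → ZMod 2) : QState n → ℂ :=
  (Uf f).mulVec (plusV n)

/-- The Pauli string `X^x Z^z`, acting as `|w⟩ ↦ (−1)^{z·w}|w ⊕ x⟩`. -/
noncomputable def XZmat {n : ℕ} (x z : QState n) : Matrix (QState n) (QState n) ℂ :=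
  Matrix.of fun u w => if u = w + x then sgn (∑ i, z i * w i) else 0

/-- Bell-sampling probabilities `P_f(x,z) = 2^{−n}|⟨ψ_f|X^x Z^z|ψ_f⟩|²`. -/
noncomputable def Pbell {n : ℕ} (f : QState n → ZMod 2) (x z : QState n) : ℝ :=
  ((2 : ℝ) ^ n)⁻¹ *
    Complex.normSq (∑ u : QState n, (starRingEnd ℂ) (ψ f u) * ((XZmat x z).mulVec (ψ f)) u)

lemma sgn_add (a b : ZMod 2) : sgn (a + b) = sgn a * sgn b := by
  rw [sgn, sgn, sgn, ← pow_add, ZMod.val_add, ← neg_one_pow_eq_pow_mod_two]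

lemma conj_sgn (a : ZMod 2) : (starRingEnd ℂ) (sgn a) = sgn a := by
  simp [sgn]

lemma psi_apply {n : ℕ} (f : QState n → ZMod 2) (u : QState n) :
    ψ f u = sgn (f u) * (((Real.sqrt 2)⁻¹ : ℝ) ^ n : ℝ) := by
  simp [ψ, Uf, plusV, Matrix.mulVec_diagonal]

/-- Up to normalization, the Bell amplitude at `(x, z)` is the character sum of
`u ↦ f (u + x) + f u + z · u`. -/
lemma Pbell_eq {n : ℕ} (f : QState n → ZMod 2) (x z : QState n) :
    Pbell f x z = ((2 : ℝ) ^ n)⁻¹ * Complex.normSq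
      (((((Real.sqrt 2)⁻¹ : ℝ) ^ n : ℝ) : ℂ) ^ 2 *
        ∑ u : QState n, sgn (f (u + x) + f u + ∑ i, z i * u i)) := by
  unfold Pbell
  congr 2
  simp only [Matrix.mulVec, dotProduct, XZmat, Matrix.of_apply, Finset.mul_sum]
  rw [Finset.sum_comm]
  refine Finset.sum_congr rfl fun w _ => ?_
  rw [Finset.sum_eq_single (w + x) (fun u _ hu => by simp [hu]) (by simp)]
  simp only [psi_apply, map_mul, conj_sgn, Complex.conj_ofReal, sgn_add, if_true]
  ring

lemma DegLE.add {n D : ℕ} {f g : QState n → ZMod 2} (hf : DegLE n D f) (hg : DegLE n D g) :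
    DegLE n D fun u => f u + g u := by
  obtain ⟨c, hc, hf⟩ := hf
  obtain ⟨d, hd, hg⟩ := hg
  refine ⟨fun T => c T + d T, fun T hT => by simp [hc T hT, hd T hT], fun u => ?_⟩
  simp only [hf, hg, add_mul, Finset.sum_add_distrib]

lemma DegLE.sum {n D : ℕ} {ι : Type*} (s : Finset ι) {f : ι → QState n → ZMod 2}
    (hf : ∀ i, DegLE n D (f i)) : DegLE n D fun u => ∑ i ∈ s, f i u := by
  classical
  induction s using Finset.induction_on with
  | empty => exact ⟨0, by simp, by simp⟩
  | insert a s ha ih =>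
    simp only [Finset.sum_insert ha]
    exact (hf a).add ih

lemma degLE_monomial {n D : ℕ} (a : ZMod 2) {T : Finset (Fin n)} (hT : T.card ≤ D) :
    DegLE n D fun u => a * ∏ i ∈ T, u i := by
  refine ⟨Pi.single T a, fun S hS => ?_, fun u => ?_⟩
  · exact Pi.single_eq_of_ne (fun h => by subst h; omega) _
  · rw [Finset.sum_eq_single T (fun S _ hS => by simp [Pi.single_eq_of_ne hS]) (by simp)]
    simp

lemma DegLE.comp_perm {n D : ℕ} {f : QState n → ZMod 2} (hf : DegLE n D f)
    (e : Equiv.Perm (Fin n)) : DegLE n D fun u => f fun i => u (e i) := by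
  obtain ⟨c, hc, hf⟩ := hf
  refine ⟨fun T => c (T.map e.symm.toEmbedding), fun T hT => hc _ (by simpa using hT),
    fun u => ?_⟩
  have hmap : ∀ T : Finset (Fin n),
      (T.map e.toEmbedding).map e.symm.toEmbedding = T := fun T => by
    ext i
    simp
  rw [← Equiv.sum_comp e.finsetCongr]
  simp [hf, hmap, Finset.prod_map]

/-- The quadratic form `u_j (w · u)` has degree at most two. -/
lemma degLE_coord_mul_linear {n D : ℕ} (hD : 2 ≤ D) (j : Fin n) (w : QState n) :
    DegLE n D fun u => u j * ∑ i, w i * u i := by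
  have h : ∀ i, DegLE n D fun u => w i * ∏ l ∈ ({j, i} : Finset (Fin n)), u l := fun i =>
    degLE_monomial _ (Finset.card_le_two.trans hD)
  convert DegLE.sum Finset.univ h using 2 with u
  rw [Finset.mul_sum]
  refine Finset.sum_congr rfl fun i _ => ?_
  by_cases hij : j = i
  · subst hij
    have hsq : u j * u j = u j := by
      generalize u j = a
      revert a
      decide
    simp only [Finset.pair_eq_singleton, Finset.prod_singleton]
    rw [mul_left_comm, hsq]
  · rw [Finset.prod_pair hij]
    ring

/-- Permuting the variables and adding a polynomial of degree at most `D` is a bijection of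
`Ω_D(n)`. -/
def Omega.permAdd {n D : ℕ} (e : Equiv.Perm (Fin n)) (q : QState n → ZMod 2)
    (hq : DegLE n D q) : Omega n D ≃ Omega n D where
  toFun f := ⟨fun u => f.1 (fun i => u (e i)) + q u, (f.2.comp_perm e).add hq⟩
  invFun g := ⟨fun u => g.1 (fun i => u (e.symm i)) + q (fun i => u (e.symm i)),
    (g.2.comp_perm e.symm).add (hq.comp_perm e.symm)⟩
  left_inv f := by
    ext u
    simp [add_assoc, CharTwo.add_self_eq_zero]
  right_inv g := by
    ext u
    simp [add_assoc, CharTwo.add_self_eq_zero]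

lemma exists_perm_of_card_suppF_eq {n : ℕ} {x x' : QState n}
    (h : (suppF x).card = (suppF x').card) :
    ∃ e : Equiv.Perm (Fin n), ∀ i, x' (e i) = x i := by
  have hcard : Fintype.card {i // x i = 1} = Fintype.card {i // x' i = 1} := by
    simpa only [Fintype.card_subtype, suppF] using h
  let e₀ := Fintype.equivOfCardEq hcard
  refine ⟨e₀.extendSubtype, fun i => ?_⟩
  have hbit : ∀ a b : ZMod 2, a ≠ 1 → b ≠ 1 → a = b := by decide
  by_cases hi : x i = 1
  · rw [hi]
    exact e₀.extendSubtype_mem i hi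
  · exact hbit _ _ (e₀.extendSubtype_not_mem i hi) hi

lemma mul_eq_zero_of_disjoint_suppF {n : ℕ} {x z : QState n} (h : suppF z ∩ suppF x = ∅)
    (i : Fin n) : z i * x i = 0 := by
  have hbit : ∀ a b : ZMod 2, ¬(a = 1 ∧ b = 1) → a * b = 0 := by decide
  refine hbit _ _ fun hi => ?_
  have : i ∈ suppF z ∩ suppF x := by simp [suppF, hi]
  simp [h] at this

/-- (Hiding for degree-D Bell sampling.)  Let `n ≥ 1`, `D ≥ 2`, and
`0 ≤ k ≤ n−1`.  For any two outcomes `(x,z)` and `(x′,z′)` in the sector with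
`|supp x| = |supp x′| = n−k`, `supp z ∩ supp x = ∅` and `supp z′ ∩ supp x′ = ∅`, there
is a bijection `τ` of `Ω_D(n)` with `P_{τ(f)}(x′,z′) = P_f(x,z)` for every
`f ∈ Ω_D(n)`; hence for uniformly random `f ∈ Ω_D(n)`, the random variable `P_f(x,z)`
has the same distribution at every outcome of this sector. -/
theorem bell_hiding {n D k : ℕ} (hn : 1 ≤ n) (hD : 2 ≤ D) (hk : k ≤ n - 1)
    (x z x' z' : QState n)
    (hx : (suppF x).card = n - k) (hx' : (suppF x').card = n - k)
    (hz : suppF z ∩ suppF x = ∅) (hz' : suppF z' ∩ suppF x' = ∅) :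
    ∃ τ : Omega n D ≃ Omega n D,
      ∀ f : Omega n D, Pbell ((τ f) : Omega n D).1 x' z' = Pbell f.1 x z := by
  obtain ⟨e, he⟩ := exists_perm_of_card_suppF_eq (hx.trans hx'.symm)
  obtain ⟨j, hj⟩ : (suppF x').Nonempty := Finset.card_pos.mp (by omega)
  have hj : x' j = 1 := by simpa [suppF] using hj
  let w : QState n := fun i => z' i + z (e.symm i)
  have hw : ∑ i, w i * x' i = 0 := Finset.sum_eq_zero fun i _ => by
    have h := mul_eq_zero_of_disjoint_suppF hz (e.symm i)
    rw [← he, Equiv.apply_symm_apply] at h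
    simp [w, add_mul, h, mul_eq_zero_of_disjoint_suppF hz' i]
  refine ⟨Omega.permAdd e _ (degLE_coord_mul_linear hD j w), fun f => ?_⟩
  rw [Pbell_eq, Pbell_eq,
    ← Equiv.sum_comp (Equiv.arrowCongr e.symm (Equiv.refl (ZMod 2)))
      fun u => sgn (f.1 (u + x) + f.1 u + ∑ i, z i * u i)]
  congr 3
  refine Finset.sum_congr rfl fun u _ => ?_
  have hshift : (fun i => (u + x') (e i)) = (fun i => u (e i)) + x := by
    ext i
    simp [he]
  have hlin : ∑ i, w i * u i = ∑ i, z' i * u i + ∑ i, z i * u (e i) := by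
    simp only [w, add_mul, Finset.sum_add_distrib]
    rw [← Equiv.sum_comp e fun i => z (e.symm i) * u i]
    simp
  have hlin' : ∑ i, w i * (u + x') i = ∑ i, w i * u i := by
    simp only [Pi.add_apply, mul_add, Finset.sum_add_distrib, hw, add_zero]
  have hu : (Equiv.arrowCongr e.symm (Equiv.refl (ZMod 2))) u = fun i => u (e i) := rfl
  rw [hu]
  congr 1
  change f.1 (fun i => (u + x') (e i)) + (u + x') j * ∑ i, w i * (u + x') i
      + (f.1 (fun i => u (e i)) + u j * ∑ i, w i * u i) + ∑ i, z' i * u i = _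
  rw [hshift, hlin', Pi.add_apply, hj, hlin]
  generalize f.1 ((fun i => u (e i)) + x) = a
  generalize f.1 (fun i => u (e i)) = b
  generalize ∑ i, z' i * u i = c
  generalize ∑ i, z i * u (e i) = d
  generalize u j = v
  revert a b c d v
  decide

end Stmt17
end

section
/- (Power law for fidelity versus acceptance fraction in the [[8,3,2]] error-detection model.) Fix an integer n_b ≥ 1. The functions p ↦ S̄₁(p)/S̄₀(p) and p ↦ F̄₁(p)/F̄₀(p) are differentiable at p = 0, take the value 1 at p = 0, and their derivatives at p = 0 are +8·n_b and −7·n_b, respectively; i.e., S̄₁/S̄₀ = 1 + 8 n_b p + O(p²) and F̄₁/F̄₀ = 1 − 7 n_b p + O(p²), so that to first order the fidelity–acceptance trade-off follows a power law with exponent −7/8. -/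
open scoped BigOperators

namespace Stmt19

noncomputable section

/-- `P_k(p) = C(8,k) p^k (1−p)^{8−k}`: probability of exactly `k` dephasing errors in a
block of 8 physical qubits. -/
def Pk (k : ℕ) (p : ℝ) : ℝ := (Nat.choose 8 k : ℝ) * p ^ k * (1 - p) ^ (8 - k)

/-- `ε(p)`: the probability that a block stabilizer is violated (odd number of errors). -/
def eps (p : ℝ) : ℝ := Pk 1 p + Pk 3 p + Pk 5 p + Pk 7 p

/-- `p⁻ = 7/8`: logical-fault probability given a violated stabilizer. -/
def pminus : ℝ := 7 / 8

/-- `p⁺(p)`: logical-fault probability given a satisfied stabilizer. -/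
def pplus (p : ℝ) : ℝ := (Pk 2 p + 4 / 5 * Pk 4 p + Pk 6 p) / (1 - eps p)

/-- `S_j(p) = C(n_b,j) ε^j (1−ε)^{n_b−j}`: probability of exactly `j` violated
stabilizers among `n_b` blocks. -/
def Sj (nb j : ℕ) (p : ℝ) : ℝ := (Nat.choose nb j : ℝ) * eps p ^ j * (1 - eps p) ^ (nb - j)

/-- `F_j(p) = (1−p⁻)^j (1−p⁺)^{n_b−j}`: probability of no logical fault given `j`
violated stabilizers. -/
def Fj (nb j : ℕ) (p : ℝ) : ℝ := (1 - pminus) ^ j * (1 - pplus p) ^ (nb - j)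

/-- The acceptance fraction `S̄_m(p) = Σ_{j≤m} S_j(p)`. -/
def Sbar (nb m : ℕ) (p : ℝ) : ℝ := ∑ j ∈ Finset.range (m + 1), Sj nb j p

/-- The post-selected fidelity `F̄_m(p) = (Σ_{j≤m} S_j F_j)/S̄_m(p)`. -/
def Fbar (nb m : ℕ) (p : ℝ) : ℝ :=
  (∑ j ∈ Finset.range (m + 1), Sj nb j p * Fj nb j p) / Sbar nb m p

theorem eps_zero : eps 0 = 0 := by simp [eps, Pk]

theorem pplus_zero : pplus 0 = 0 := by simp [pplus, Pk]

theorem hasDerivAt_Pk_zero (k : ℕ) (hk : 1 ≤ k) :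
    HasDerivAt (Pk k) (if k = 1 then 8 else 0) 0 := by
  have h := ((hasDerivAt_pow k (0 : ℝ)).const_mul (Nat.choose 8 k : ℝ)).mul
    (((hasDerivAt_id (0 : ℝ)).const_sub 1).pow (8 - k))
  refine h.congr_deriv ?_
  have hk0 : k ≠ 0 := by omega
  split_ifs with h1
  · simp [h1]
  · simp [hk0, show k - 1 ≠ 0 by omega]

theorem hasDerivAt_eps_zero : HasDerivAt eps 8 0 := by
  have h := (((hasDerivAt_Pk_zero 1 (by norm_num)).add (hasDerivAt_Pk_zero 3 (by norm_num))).add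
    (hasDerivAt_Pk_zero 5 (by norm_num))).add (hasDerivAt_Pk_zero 7 (by norm_num))
  exact h.congr_deriv (by norm_num)

theorem hasDerivAt_pplus_zero : HasDerivAt pplus 0 0 := by
  have h := (((hasDerivAt_Pk_zero 2 (by norm_num)).add
    ((hasDerivAt_Pk_zero 4 (by norm_num)).const_mul (4 / 5))).add
    (hasDerivAt_Pk_zero 6 (by norm_num))).div (hasDerivAt_eps_zero.const_sub 1)
    (by simp [eps_zero])
  exact h.congr_deriv (by simp [Pk])

theorem Sj_zero_zero (nb : ℕ) : Sj nb 0 0 = 1 := by simp [Sj, eps_zero]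

theorem Sj_one_zero (nb : ℕ) : Sj nb 1 0 = 0 := by simp [Sj, eps_zero]

theorem Fj_at_zero (nb j : ℕ) : Fj nb j 0 = (1 / 8) ^ j := by
  norm_num [Fj, pplus_zero, pminus]

theorem hasDerivAt_Sj_zero (nb : ℕ) : HasDerivAt (Sj nb 0) (-8 * (nb : ℝ)) 0 := by
  have h := ((hasDerivAt_eps_zero.pow 0).const_mul (Nat.choose nb 0 : ℝ)).mul
    ((hasDerivAt_eps_zero.const_sub 1).pow (nb - 0))
  exact h.congr_deriv (by simp [eps_zero]; ring)

theorem hasDerivAt_Sj_one (nb : ℕ) : HasDerivAt (Sj nb 1) (8 * (nb : ℝ)) 0 := by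
  have h := ((hasDerivAt_eps_zero.pow 1).const_mul (Nat.choose nb 1 : ℝ)).mul
    ((hasDerivAt_eps_zero.const_sub 1).pow (nb - 1))
  exact h.congr_deriv (by simp [eps_zero]; ring)

theorem hasDerivAt_Fj (nb j : ℕ) : HasDerivAt (Fj nb j) 0 0 := by
  have h := ((hasDerivAt_pplus_zero.const_sub 1).pow (nb - j)).const_mul ((1 - pminus) ^ j)
  exact h.congr_deriv (by simp)

theorem Sbar_zero_eq (nb : ℕ) : Sbar nb 0 = Sj nb 0 := by
  ext p; simp [Sbar]

theorem Sbar_one_eq (nb : ℕ) : Sbar nb 1 = Sj nb 0 + Sj nb 1 := by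
  ext p; simp [Sbar, Finset.sum_range_succ]

theorem Fbar_zero_eq (nb : ℕ) : Fbar nb 0 = Sj nb 0 * Fj nb 0 / Sj nb 0 := by
  ext p; simp [Fbar, Sbar_zero_eq]

theorem Fbar_one_eq (nb : ℕ) :
    Fbar nb 1 = (Sj nb 0 * Fj nb 0 + Sj nb 1 * Fj nb 1) / (Sj nb 0 + Sj nb 1) := by
  ext p; simp [Fbar, Sbar_one_eq, Finset.sum_range_succ]

theorem Fbar_zero_at_zero (nb : ℕ) : Fbar nb 0 0 = 1 := by
  simp [Fbar_zero_eq, Sj_zero_zero, Fj_at_zero]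

theorem Fbar_one_at_zero (nb : ℕ) : Fbar nb 1 0 = 1 := by
  simp [Fbar_one_eq, Sj_zero_zero, Sj_one_zero, Fj_at_zero]

theorem hasDerivAt_Fbar_zero (nb : ℕ) : HasDerivAt (Fbar nb 0) 0 0 := by
  rw [Fbar_zero_eq]
  have h := ((hasDerivAt_Sj_zero nb).mul (hasDerivAt_Fj nb 0)).div (hasDerivAt_Sj_zero nb)
    (by simp [Sj_zero_zero])
  exact h.congr_deriv (by simp [Sj_zero_zero, Fj_at_zero])

theorem hasDerivAt_Fbar_one (nb : ℕ) : HasDerivAt (Fbar nb 1) (-7 * (nb : ℝ)) 0 := by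
  rw [Fbar_one_eq]
  have h := (((hasDerivAt_Sj_zero nb).mul (hasDerivAt_Fj nb 0)).add
    ((hasDerivAt_Sj_one nb).mul (hasDerivAt_Fj nb 1))).div
    ((hasDerivAt_Sj_zero nb).add (hasDerivAt_Sj_one nb)) (by simp [Sj_zero_zero, Sj_one_zero])
  exact h.congr_deriv (by simp [Sj_zero_zero, Sj_one_zero, Fj_at_zero]; ring)

/-- (Power law for fidelity versus acceptance fraction in the
`[[8,3,2]]` error-detection model.)  The functions `p ↦ S̄₁(p)/S̄₀(p)` and
`p ↦ F̄₁(p)/F̄₀(p)` take the value `1` at `p = 0` and are differentiable there with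
derivatives `+8·n_b` and `−7·n_b` respectively; i.e. `S̄₁/S̄₀ = 1 + 8 n_b p + O(p²)`
and `F̄₁/F̄₀ = 1 − 7 n_b p + O(p²)`, so that to first order the fidelity–acceptance
trade-off follows a power law with exponent `−7/8`. -/
theorem powerlaw (nb : ℕ) (hnb : 1 ≤ nb) :
    (Sbar nb 1 0 / Sbar nb 0 0 = 1 ∧ Fbar nb 1 0 / Fbar nb 0 0 = 1) ∧
    HasDerivAt (fun p => Sbar nb 1 p / Sbar nb 0 p) (8 * (nb : ℝ)) 0 ∧
    HasDerivAt (fun p => Fbar nb 1 p / Fbar nb 0 p) (-7 * (nb : ℝ)) 0 := by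
  refine ⟨⟨?_, ?_⟩, ?_, ?_⟩
  · simp [Sbar_zero_eq, Sbar_one_eq, Sj_zero_zero, Sj_one_zero]
  · simp [Fbar_zero_at_zero, Fbar_one_at_zero]
  · rw [Sbar_zero_eq, Sbar_one_eq]
    have h := ((hasDerivAt_Sj_zero nb).add (hasDerivAt_Sj_one nb)).div (hasDerivAt_Sj_zero nb)
      (by simp [Sj_zero_zero])
    exact h.congr_deriv (by simp [Sj_zero_zero, Sj_one_zero])
  · have h := (hasDerivAt_Fbar_one nb).div (hasDerivAt_Fbar_zero nb)
      (by simp [Fbar_zero_at_zero])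
    exact h.congr_deriv (by simp [Fbar_zero_at_zero, Fbar_one_at_zero])

end

end Stmt19
end
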